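/- arXiv:1608.00831 — 4 statements merged into one kernel-verified Lean document; each statement's English description precedes it below -/
import Mathlib

section
/- Bound on the starting weights (Lemma 6.2): Let 0<β<1, let m be a positive integer, and let 0<σ_1<σ_2<⋯<σ_m be strictly increasing positive real exponents. For each integer n ≥ 1, let W_{n,k}^{(β,σ)} (k=1,…,m) be the starting weights defined by the Vandermonde system. Then there exists a constant C>0, independent of n, such that |W_{n,k}^{(β,σ)}| ≤ C(n^{σ_m+β−2} + n^{β−1}) for all n ≥ 1 and all 1 ≤ k ≤ m. -/
/-- Generalized binomial coefficient `C(β,i) = β(β−1)⋯(β−i+1)/i!`. -/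
noncomputable def genBinom (β : ℝ) (i : ℕ) : ℝ :=
  (∏ j ∈ Finset.range i, (β - (j : ℝ))) / (Nat.factorial i : ℝ)

/-- Taylor coefficients of the generating function `((1+z)/(2(1−z)))^β`. -/
noncomputable def omegaCoef (β : ℝ) (j : ℕ) : ℝ :=
  (2 : ℝ) ^ (-β) * ∑ i ∈ Finset.range (j + 1),
    genBinom β i * Real.Gamma (β + ((j - i : ℕ) : ℝ)) /
      (Real.Gamma β * (Nat.factorial (j - i) : ℝ))

/-- `W` solves the Vandermonde system defining the starting weights
`W_{n,k}^{(β,σ)}`, `k = 1,…,m`. -/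
def IsStartWeights (β : ℝ) (σ : ℕ → ℝ) (m n : ℕ) (W : ℕ → ℝ) : Prop :=
  ∀ r ∈ Finset.Icc 1 m,
    ∑ k ∈ Finset.Icc 1 m, W k * (k : ℝ) ^ (σ r) =
      Real.Gamma (σ r + 1) / Real.Gamma (σ r + 1 + β) * (n : ℝ) ^ (σ r + β) -
        ∑ k ∈ Finset.range (n + 1), omegaCoef β (n - k) * (k : ℝ) ^ (σ r)

open Filter Asymptotics Finset Topology
open scoped Nat

/-- Taylor coefficients of `(1 - z) ^ (-s)`. -/
noncomputable def risingCoef (s : ℝ) (n : ℕ) : ℝ :=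
  (∏ j ∈ range n, (s + j)) / n !

lemma risingCoef_zero (s : ℝ) : risingCoef s 0 = 1 := by simp [risingCoef]

lemma risingCoef_succ (s : ℝ) (n : ℕ) :
    risingCoef s (n + 1) = risingCoef s n * ((s + n) / (n + 1)) := by
  simp only [risingCoef, prod_range_succ, Nat.factorial_succ]
  push_cast
  have : (n ! : ℝ) ≠ 0 := by positivity
  have : (n : ℝ) + 1 ≠ 0 := by positivity
  field_simp

lemma mul_risingCoef_add_one (s : ℝ) (n : ℕ) :
    s * risingCoef (s + 1) n = (s + n) * risingCoef s n := by
  induction n with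
  | zero => simp [risingCoef_zero]
  | succ n ih =>
    have : (n : ℝ) + 1 ≠ 0 := by positivity
    rw [risingCoef_succ, risingCoef_succ, ← mul_assoc, ih]
    push_cast
    ring

lemma risingCoef_pos {s : ℝ} (hs : 0 < s) (n : ℕ) : 0 < risingCoef s n := by
  unfold risingCoef
  have : 0 < ∏ j ∈ range n, (s + j) := prod_pos fun j _ => by positivity
  positivity

lemma Gamma_add_natCast_eq_risingCoef {s : ℝ} (hs : 0 < s) (n : ℕ) :
    Real.Gamma (s + n) / (Real.Gamma s * n !) = risingCoef s n := by
  have h0 := (Real.Gamma_pos_of_pos hs).ne'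
  have : Real.Gamma (s + n) = Real.Gamma s * ∏ j ∈ range n, (s + j) := by
    induction n with
    | zero => simp
    | succ n ih =>
      rw [prod_range_succ, ← mul_assoc, ← ih]
      push_cast
      rw [← add_assoc, Real.Gamma_add_one (by positivity)]
      ring
  rw [this, risingCoef]
  field_simp

lemma genBinom_zero (β : ℝ) : genBinom β 0 = 1 := by simp [genBinom]

lemma genBinom_succ (β : ℝ) (n : ℕ) :
    genBinom β (n + 1) = genBinom β n * ((β - n) / (n + 1)) := by
  simp only [genBinom, prod_range_succ, Nat.factorial_succ]
  push_cast
  have : (n ! : ℝ) ≠ 0 := by positivity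
  have : (n : ℝ) + 1 ≠ 0 := by positivity
  field_simp

lemma genBinom_sub_one_mul (β : ℝ) (n : ℕ) :
    β * genBinom (β - 1) n = (n + 1) * genBinom β (n + 1) := by
  induction n with
  | zero => simp [genBinom_zero, genBinom_succ]
  | succ n ih =>
    have : (n : ℝ) + 1 ≠ 0 := by positivity
    have : (n : ℝ) + 1 + 1 ≠ 0 := by positivity
    rw [genBinom_succ, genBinom_succ β (n + 1), ← mul_assoc, ih]
    push_cast
    field_simp
    ring

lemma genBinom_eq_choose (β : ℝ) (n : ℕ) : genBinom β n = Ring.choose β n := by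
  rw [Ring.choose_eq_smul, genBinom, smul_eq_mul, div_eq_inv_mul]
  congr 1
  induction n with
  | zero => simp
  | succ n ih =>
    rw [prod_range_succ, ih, descPochhammer_succ_right, Polynomial.smeval_mul,
      Polynomial.smeval_sub, Polynomial.smeval_X, Polynomial.smeval_natCast]
    simp

lemma risingCoef_eq_genBinom (s : ℝ) (n : ℕ) :
    risingCoef s n = (-1) ^ n * genBinom (-s) n := by
  induction n with
  | zero => simp [risingCoef_zero, genBinom_zero]
  | succ n ih => rw [risingCoef_succ, genBinom_succ, ih]; ring

/-- The formal power series `(1 - X) ^ (-s)`. -/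
noncomputable def risingSeries (s : ℝ) : PowerSeries ℝ := PowerSeries.mk (risingCoef s)

lemma risingSeries_mul (s t : ℝ) :
    risingSeries s * risingSeries t = risingSeries (s + t) := by
  ext n
  simp only [risingSeries, PowerSeries.coeff_mul, PowerSeries.coeff_mk]
  rw [risingCoef_eq_genBinom, genBinom_eq_choose, neg_add,
    Ring.add_choose_eq n (Commute.all _ _), mul_sum]
  refine sum_congr rfl fun p hp => ?_
  rw [risingCoef_eq_genBinom, risingCoef_eq_genBinom, genBinom_eq_choose, genBinom_eq_choose,
    ← mem_antidiagonal.1 hp, pow_add]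
  ring

lemma risingSeries_neg_one : risingSeries (-1) = 1 - PowerSeries.X := by
  ext n
  simp only [risingSeries, PowerSeries.coeff_mk, map_sub, PowerSeries.coeff_one,
    PowerSeries.coeff_X]
  rcases n with _ | _ | n
  · simp [risingCoef_zero]
  · simp [risingCoef]
  · simp [risingCoef, prod_range_succ']

lemma risingSeries_mul_one_sub (s : ℝ) :
    risingSeries s * (1 - PowerSeries.X) = risingSeries (s - 1) := by
  rw [← risingSeries_neg_one, risingSeries_mul, sub_eq_add_neg]

/-- The formal power series of `((1 + z) / 2) ^ β`. -/
noncomputable def halfSumSeries (β : ℝ) : PowerSeries ℝ :=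
  PowerSeries.mk fun i => (2 : ℝ) ^ (-β) * genBinom β i

lemma omegaCoef_eq_coeff {β : ℝ} (hβ : 0 < β) (j : ℕ) :
    omegaCoef β j = PowerSeries.coeff j (halfSumSeries β * risingSeries β) := by
  rw [omegaCoef, PowerSeries.coeff_mul, Nat.sum_antidiagonal_eq_sum_range_succ_mk, mul_sum]
  refine sum_congr rfl fun i _ => ?_
  simp only [halfSumSeries, risingSeries, PowerSeries.coeff_mk]
  rw [← Gamma_add_natCast_eq_risingCoef hβ]
  ring
/-- A nonzero exponential sum with `n` distinct frequencies has fewer than `n` real zeros. -/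
lemma exp_sum_coeff_eq_zero (n : ℕ) (e c x : Fin n → ℝ) (he : Function.Injective e)
    (hx : StrictMono x) (h : ∀ j, ∑ i, c i * Real.exp (e i * x j) = 0) : c = 0 := by
  induction n with
  | zero => exact Subsingleton.elim _ _
  | succ n ih =>
    set g : ℝ → ℝ := fun t => ∑ i, c i * Real.exp ((e i - e 0) * t) with hg
    have hgd : ∀ t, HasDerivAt g (∑ i, c i * (Real.exp ((e i - e 0) * t) * (e i - e 0))) t := by
      intro t
      refine HasDerivAt.fun_sum fun i _ => HasDerivAt.const_mul _ ?_
      simpa using ((hasDerivAt_id t).const_mul (e i - e 0)).exp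
    have hg0 : ∀ j, g (x j) = 0 := by
      intro j
      have : g (x j) = Real.exp (-(e 0 * x j)) * ∑ i, c i * Real.exp (e i * x j) := by
        rw [hg, mul_sum]
        refine sum_congr rfl fun i _ => ?_
        rw [mul_left_comm, ← Real.exp_add]
        ring_nf
      rw [this, h, mul_zero]
    have hroll : ∀ j : Fin n, ∃ y ∈ Set.Ioo (x j.castSucc) (x j.succ),
        ∑ i, c i * (Real.exp ((e i - e 0) * y) * (e i - e 0)) = 0 := fun j =>
      exists_hasDerivAt_eq_zero (hx (Fin.castSucc_lt_succ))
        (fun t _ => (hgd t).continuousAt.continuousWithinAt) (by rw [hg0, hg0])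
        (fun t _ => hgd t)
    choose y hy hy0 using hroll
    have hymono : StrictMono y := by
      intro i j hij
      exact ((hy i).2.trans_le (hx.monotone (by
        rw [Fin.le_def, Fin.val_succ, Fin.val_castSucc]
        exact hij))).trans (hy j).1
    have hz := ih (fun i => e i.succ - e 0) (fun i => c i.succ * (e i.succ - e 0)) y
      (fun i j hij => Fin.succ_injective _ (he (by simpa using hij))) hymono (fun j => by
        have := hy0 j
        rw [Fin.sum_univ_succ] at this
        simp only [sub_self, mul_zero, zero_add] at this
        rw [← this]
        exact sum_congr rfl fun i _ => by ring)
    have hs : ∀ i : Fin n, c i.succ = 0 := fun i => by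
      have h1 : c i.succ * (e i.succ - e 0) = 0 := congrFun hz i
      exact (mul_eq_zero.1 h1).resolve_right
        (sub_ne_zero.2 fun hh => Fin.succ_ne_zero i (he hh))
    have h0 : c 0 = 0 := by
      have := h 0
      rw [Fin.sum_univ_succ] at this
      simpa [hs, Real.exp_ne_zero] using this
    funext i
    refine Fin.cases h0 hs i

/-- The solution of a generalized Vandermonde system is controlled by its right-hand side. -/
lemma exists_bound_of_vandermonde (m : ℕ) (σ : ℕ → ℝ)
    (hσ : StrictMonoOn σ (Set.Icc 1 m)) :
    ∃ K : ℝ, 0 ≤ K ∧ ∀ (W : ℕ → ℝ) (B : ℝ),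
      (∀ r ∈ Icc 1 m, |∑ k ∈ Icc 1 m, W k * (k : ℝ) ^ σ r| ≤ B) →
      ∀ k ∈ Icc 1 m, |W k| ≤ K * B := by
  have hsum : ∀ f : ℕ → ℝ, ∑ k ∈ Icc 1 m, f k = ∑ i : Fin m, f (i + 1) := by
    intro f
    rw [← sum_range (fun i => f (i + 1)), range_eq_Ico, sum_Ico_add' f 0 m 1]
    rfl
  let M : Matrix (Fin m) (Fin m) ℝ := fun r k => ((k : ℕ) + 1 : ℝ) ^ σ (r + 1)
  have hM : IsUnit M.det := by
    rw [isUnit_iff_ne_zero]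
    intro hdet
    obtain ⟨v, hv, hv0⟩ := Matrix.exists_vecMul_eq_zero_iff.2 hdet
    refine hv (exp_sum_coeff_eq_zero m (fun i => σ (i + 1)) v
      (fun k => Real.log ((k : ℕ) + 1)) ?_ ?_ ?_)
    · intro i j hij
      have := hσ.injOn (x₁ := (i : ℕ) + 1) (x₂ := (j : ℕ) + 1) ⟨by omega, by omega⟩
        ⟨by omega, by omega⟩ hij
      exact Fin.ext (by omega)
    · intro i j hij
      refine Real.log_lt_log (by positivity) ?_
      have : (i : ℕ) < j := hij
      have : ((i : ℕ) : ℝ) < (j : ℕ) := by exact_mod_cast this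
      linarith
    · intro k
      have := congrFun hv0 k
      simp only [Matrix.vecMul, dotProduct, Pi.zero_apply] at this
      rw [← this]
      refine sum_congr rfl fun i _ => ?_
      simp only [M]
      rw [Real.rpow_def_of_pos (by positivity), mul_comm (Real.log _)]
  refine ⟨∑ i, ∑ j, |M⁻¹ i j|, by positivity, fun W B hW k hk => ?_⟩
  have hk' := mem_Icc.1 hk
  have hB : 0 ≤ B := (abs_nonneg _).trans (hW k hk)
  let w : Fin m → ℝ := fun i => W (i + 1)
  let b : Fin m → ℝ := M.mulVec w
  have hb : ∀ i, |b i| ≤ B := by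
    intro i
    have := hW (i + 1) (mem_Icc.2 ⟨by omega, by omega⟩)
    rw [hsum] at this
    convert this using 2
    simp only [b, w, M, Matrix.mulVec, dotProduct]
    refine sum_congr rfl fun j _ => ?_
    push_cast
    ring
  have hw : w = M⁻¹.mulVec b := by
    simp only [b, Matrix.mulVec_mulVec, Matrix.nonsing_inv_mul M hM, Matrix.one_mulVec]
  have hk1 : W k = w ⟨k - 1, by omega⟩ := by
    simp only [w]
    congr 1
    omega
  rw [hk1, hw]
  simp only [Matrix.mulVec, dotProduct]
  calc _ ≤ ∑ j, |M⁻¹ ⟨k - 1, by omega⟩ j| * B := by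
        refine (abs_sum_le_sum_abs _ _).trans (sum_le_sum fun j _ => ?_)
        rw [abs_mul]
        exact mul_le_mul_of_nonneg_left (hb j) (abs_nonneg _)
    _ = (∑ j, |M⁻¹ ⟨k - 1, by omega⟩ j|) * B := by rw [sum_mul]
    _ ≤ _ := by
        refine mul_le_mul_of_nonneg_right ?_ hB
        exact single_le_sum (f := fun i => ∑ j, |M⁻¹ i j|) (fun i _ => by positivity)
          (mem_univ _)

section Remainder

open intervalIntegral

lemma hasDerivAt_pow_mul_two_sub_rpow (p : ℝ) (j : ℕ) {t : ℝ} (ht : t < 2) :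
    HasDerivAt (fun t : ℝ => t ^ (j + 1) * (2 - t) ^ p)
      ((j + 1) * (t ^ j * (2 - t) ^ p) - p * (t ^ (j + 1) * (2 - t) ^ (p - 1))) t := by
  have h1 : HasDerivAt (fun t : ℝ => (2 - t) ^ p) (-1 * p * (2 - t) ^ (p - 1)) t :=
    ((hasDerivAt_id t).const_sub 2).rpow_const (Or.inl (by simp; linarith))
  refine ((hasDerivAt_pow (j + 1) t).mul h1).congr_deriv ?_
  push_cast
  ring

lemma intervalIntegrable_pow_mul_two_sub_rpow (p : ℝ) (j : ℕ) :
    IntervalIntegrable (fun t : ℝ => t ^ j * (2 - t) ^ p) MeasureTheory.volume 0 1 := by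
  refine ContinuousOn.intervalIntegrable ?_
  rw [Set.uIcc_of_le zero_le_one]
  refine (continuousOn_id.pow j).mul ((continuousOn_const.sub continuousOn_id).rpow_const ?_)
  intro t ht
  left
  exact ne_of_gt (by linarith [ht.2] : (0 : ℝ) < 2 - t)

/-- The integrals `∫₀¹ t ^ j * (2 - t) ^ p`. -/
noncomputable def twoSubIntegral (p : ℝ) (j : ℕ) : ℝ := ∫ t in (0 : ℝ)..1, t ^ j * (2 - t) ^ p

lemma twoSubIntegral_succ (p : ℝ) (j : ℕ) :
    (j + 1) * twoSubIntegral p j - p * twoSubIntegral (p - 1) (j + 1) = 1 := by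
  have := integral_eq_sub_of_hasDerivAt (a := 0) (b := 1)
    (fun t ht => hasDerivAt_pow_mul_two_sub_rpow p j (t := t) (by
      rw [Set.uIcc_of_le zero_le_one] at ht; linarith [ht.2]))
    (((intervalIntegrable_pow_mul_two_sub_rpow p j).const_mul _).sub
      ((intervalIntegrable_pow_mul_two_sub_rpow (p - 1) (j + 1)).const_mul _))
  rw [integral_sub ((intervalIntegrable_pow_mul_two_sub_rpow p j).const_mul _)
      ((intervalIntegrable_pow_mul_two_sub_rpow (p - 1) (j + 1)).const_mul _),
    integral_const_mul, integral_const_mul] at this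
  rw [twoSubIntegral, twoSubIntegral, this]
  norm_num

lemma twoSubIntegral_zero (p : ℝ) :
    (p + 1) * twoSubIntegral p 0 = 2 ^ (p + 1) - 1 := by
  have hd : ∀ t ∈ Set.uIcc (0 : ℝ) 1, HasDerivAt (fun t : ℝ => (2 - t) ^ (p + 1))
      (-(p + 1) * (t ^ 0 * (2 - t) ^ p)) t := by
    intro t ht
    rw [Set.uIcc_of_le zero_le_one] at ht
    have h1 : HasDerivAt (fun t : ℝ => (2 - t) ^ (p + 1)) (-1 * (p + 1) * (2 - t) ^ (p + 1 - 1)) t :=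
      ((hasDerivAt_id t).const_sub 2).rpow_const (Or.inl (by simp; linarith [ht.2]))
    refine h1.congr_deriv ?_
    rw [add_sub_cancel_right]
    ring
  have := integral_eq_sub_of_hasDerivAt hd
    ((intervalIntegrable_pow_mul_two_sub_rpow p 0).const_mul _)
  rw [integral_const_mul] at this
  norm_num at this
  simp only [twoSubIntegral, pow_zero, one_mul]
  linarith

lemma twoSubIntegral_sub_bounds {p : ℝ} (hp : p ≤ 0) (j : ℕ) :
    0 ≤ twoSubIntegral (p + 1) j - twoSubIntegral p j ∧
      (j + 1) * (j + 2) * (twoSubIntegral (p + 1) j - twoSubIntegral p j) ≤ 1 := by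
  have hI : twoSubIntegral (p + 1) j - twoSubIntegral p j =
      ∫ t in (0 : ℝ)..1, (t ^ j * (2 - t) ^ (p + 1) - t ^ j * (2 - t) ^ p) :=
    (integral_sub (intervalIntegrable_pow_mul_two_sub_rpow _ j)
      (intervalIntegrable_pow_mul_two_sub_rpow _ j)).symm
  have heq : ∀ t ∈ Set.Icc (0 : ℝ) 1, t ^ j * (2 - t) ^ (p + 1) - t ^ j * (2 - t) ^ p =
      (t ^ j - t ^ (j + 1)) * (2 - t) ^ p := by
    intro t ht
    rw [Real.rpow_add_one (by linarith [ht.2])]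
    ring
  have hnn : ∀ t ∈ Set.Icc (0 : ℝ) 1, 0 ≤ t ^ j - t ^ (j + 1) := by
    intro t ht
    have : t ^ j - t ^ (j + 1) = t ^ j * (1 - t) := by ring
    rw [this]
    exact mul_nonneg (pow_nonneg ht.1 _) (by linarith [ht.2])
  constructor
  · rw [hI]
    refine integral_nonneg zero_le_one fun t ht => ?_
    rw [heq t ht]
    exact mul_nonneg (hnn t ht) (Real.rpow_nonneg (by linarith [ht.2]) _)
  · have hle : twoSubIntegral (p + 1) j - twoSubIntegral p j ≤
        ∫ t in (0 : ℝ)..1, (t ^ j - t ^ (j + 1)) := by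
      rw [hI]
      refine integral_mono_on zero_le_one ((intervalIntegrable_pow_mul_two_sub_rpow _ j).sub
        (intervalIntegrable_pow_mul_two_sub_rpow _ j))
        (Continuous.intervalIntegrable (by fun_prop) _ _) fun t ht => ?_
      rw [heq t ht]
      exact mul_le_of_le_one_right (hnn t ht)
        (Real.rpow_le_one_of_one_le_of_nonpos (by linarith [ht.2]) hp)
    have hval : ∫ t in (0 : ℝ)..1, (t ^ j - t ^ (j + 1)) = 1 / (j + 1) - 1 / (j + 2) := by
      rw [integral_sub (by simp) (by simp), integral_pow, integral_pow]
      push_cast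
      norm_num
      ring
    rw [hval] at hle
    calc _ ≤ ((j : ℝ) + 1) * (j + 2) * (1 / (j + 1) - 1 / (j + 2)) := by gcongr
      _ = 1 := by field_simp; ring

end Remainder

/-- Taylor coefficients of the first divided difference `(((1 + z) / 2) ^ β - 1) / (1 - z)`. -/
noncomputable def halfSumQuotient (β : ℝ) (j : ℕ) : ℝ :=
  -(β * 2 ^ (-β) * genBinom (β - 1) j * twoSubIntegral (β - 1 - j) j)

/-- Taylor coefficients of the second order remainder
`(((1 + z) / 2) ^ β - 1 + β / 2 * (1 - z)) / (1 - z) ^ 2`. -/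
noncomputable def halfSumRemainder (β : ℝ) (j : ℕ) : ℝ :=
  β * (β - 1) * 2 ^ (-β) * genBinom (β - 2) j *
    (twoSubIntegral (β - 2 - j + 1) j - twoSubIntegral (β - 2 - j) j)

lemma halfSumQuotient_zero {β : ℝ} : halfSumQuotient β 0 = 2 ^ (-β) - 1 := by
  have h := twoSubIntegral_zero (β - 1)
  rw [sub_add_cancel] at h
  have h2 : (2 : ℝ) ^ (-β) * 2 ^ β = 1 := by rw [← Real.rpow_add two_pos]; simp
  simp only [halfSumQuotient, genBinom_zero, Nat.cast_zero, sub_zero]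
  linear_combination -(2 : ℝ) ^ (-β) * h - h2

lemma halfSumQuotient_succ {β : ℝ} (j : ℕ) :
    halfSumQuotient β (j + 1) - halfSumQuotient β j = 2 ^ (-β) * genBinom β (j + 1) := by
  have h := twoSubIntegral_succ (β - 1 - j) j
  have hj : (j : ℝ) + 1 ≠ 0 := by positivity
  have h1 := genBinom_sub_one_mul β j
  have h2 : genBinom β (j + 1) = β * genBinom (β - 1) j / (j + 1) := by
    rw [h1]; field_simp
  rw [h2]
  simp only [halfSumQuotient, genBinom_succ]
  push_cast
  rw [← sub_sub]
  field_simp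
  linear_combination β * genBinom (β - 1) j * h

lemma halfSumRemainder_zero {β : ℝ} :
    halfSumRemainder β 0 = halfSumQuotient β 0 + β / 2 := by
  have h := twoSubIntegral_zero (β - 1)
  have h' := twoSubIntegral_zero (β - 2)
  rw [sub_add_cancel] at h
  have e : β - 2 + 1 = β - 1 := by ring
  rw [e, Real.rpow_sub_one two_ne_zero] at h'
  have h2 : (2 : ℝ) ^ (-β) * 2 ^ β = 1 := by rw [← Real.rpow_add two_pos]; simp
  rw [halfSumQuotient_zero]
  simp only [halfSumRemainder, genBinom_zero, Nat.cast_zero, sub_zero, e]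
  linear_combination (2 : ℝ) ^ (-β) * ((β - 1) * h - β * h') + (β / 2 - 1) * h2

lemma halfSumRemainder_succ {β : ℝ} (j : ℕ) :
    halfSumRemainder β (j + 1) - halfSumRemainder β j = halfSumQuotient β (j + 1) := by
  have h := twoSubIntegral_succ (β - 2 - j + 1) j
  have h' := twoSubIntegral_succ (β - 2 - j) j
  have hj : (j : ℝ) + 1 ≠ 0 := by positivity
  have h1 := genBinom_sub_one_mul (β - 1) j
  have e : β - 1 - 1 = β - 2 := by ring
  rw [e] at h1
  have h2 : genBinom (β - 1) (j + 1) = (β - 1) * genBinom (β - 2) j / (j + 1) := by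
    rw [h1]; field_simp
  have e1 : β - 2 - ((j + 1 : ℕ) : ℝ) + 1 = β - 2 - j := by push_cast; ring
  have e2 : β - 2 - ((j + 1 : ℕ) : ℝ) = β - 2 - j - 1 := by push_cast; ring
  have e3 : β - 1 - ((j + 1 : ℕ) : ℝ) = β - 2 - j := by push_cast; ring
  rw [add_sub_cancel_right] at h
  simp only [halfSumRemainder, halfSumQuotient, e1, e3, h2]
  rw [e2, genBinom_succ]
  field_simp
  linear_combination β * (β - 1) * genBinom (β - 2) j * (h' - h)

lemma halfSumSeries_eq (β : ℝ) :
    halfSumSeries β = 1 - PowerSeries.C (β / 2) * (1 - PowerSeries.X) +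
      (1 - PowerSeries.X) ^ 2 * PowerSeries.mk (halfSumRemainder β) := by
  have hq : halfSumSeries β = 1 + (1 - PowerSeries.X) * PowerSeries.mk (halfSumQuotient β) := by
    ext n
    rcases n with _ | n
    · simp [halfSumSeries, sub_mul, halfSumQuotient_zero, genBinom_zero]
    · simp [halfSumSeries, sub_mul, PowerSeries.coeff_succ_X_mul, PowerSeries.coeff_one,
        halfSumQuotient_succ]
  have hr : PowerSeries.mk (halfSumQuotient β) = -PowerSeries.C (β / 2) +
      (1 - PowerSeries.X) * PowerSeries.mk (halfSumRemainder β) := by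
    ext n
    rcases n with _ | n
    · simp [sub_mul, halfSumRemainder_zero]
    · simp [sub_mul, PowerSeries.coeff_succ_X_mul, halfSumRemainder_succ]
  rw [hq, hr]
  ring

lemma abs_halfSumRemainder_le {β : ℝ} (hβ : β ≤ 2) (j : ℕ) :
    |halfSumRemainder β j| ≤ 2 ^ (-β) * |genBinom β (j + 2)| := by
  obtain ⟨h0, h1⟩ := twoSubIntegral_sub_bounds (p := β - 2 - j)
    (by have := Nat.cast_nonneg (α := ℝ) j; linarith) j
  set I := twoSubIntegral (β - 2 - j + 1) j - twoSubIntegral (β - 2 - j) j with hI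
  have e1 := genBinom_sub_one_mul β (j + 1)
  have e2 := genBinom_sub_one_mul (β - 1) j
  rw [sub_sub, one_add_one_eq_two] at e2
  push_cast at e1
  have e : halfSumRemainder β j = 2 ^ (-β) * genBinom β (j + 2) * ((j + 1) * (j + 2) * I) := by
    rw [halfSumRemainder, ← hI]
    linear_combination 2 ^ (-β) * I * (β * e2 + (j + 1) * e1)
  rw [e, abs_mul, abs_mul, abs_of_pos (by positivity : (0 : ℝ) < 2 ^ (-β)),
    abs_of_nonneg (by positivity : 0 ≤ ((j : ℝ) + 1) * (j + 2) * I)]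
  exact mul_le_of_le_one_right (by positivity) h1

lemma natCast_rpow_isTheta (p : ℝ) :
    (fun n : ℕ => (n : ℝ) ^ p) =Θ[atTop] fun n : ℕ => ((n : ℝ) + 1) ^ p := by
  refine IsTheta.rpow (Eventually.of_forall fun n => Nat.cast_nonneg n)
    (Eventually.of_forall fun n => by simp; positivity) ⟨?_, ?_⟩
  · refine IsBigO.of_bound 1 (Eventually.of_forall fun n => ?_)
    rw [Real.norm_of_nonneg (by positivity), Real.norm_of_nonneg (by positivity)]
    linarith
  · refine IsBigO.of_bound 2 ((eventually_ge_atTop 1).mono fun n hn => ?_)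
    rw [Real.norm_of_nonneg (by positivity), Real.norm_of_nonneg (by positivity)]
    have : (1 : ℝ) ≤ n := by exact_mod_cast hn
    linarith

lemma tendsto_natCast_div_natCast_add (c : ℝ) :
    Tendsto (fun n : ℕ => (n : ℝ) / (n + c)) atTop (𝓝 1) :=
  tendsto_natCast_div_add_atTop c

lemma eventually_natCast_add_pos (c : ℝ) : ∀ᶠ n : ℕ in atTop, 0 < (n : ℝ) + c := by
  filter_upwards [tendsto_natCast_atTop_atTop.eventually_gt_atTop (-c)] with n hn
  linarith

lemma GammaSeq_eq_risingCoef {s : ℝ} (hs : 0 < s) (n : ℕ) :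
    Real.GammaSeq s n = (n : ℝ) ^ s / (risingCoef s n * (n + s)) := by
  rw [Real.GammaSeq, prod_range_succ, risingCoef]
  have : (∏ j ∈ range n, (s + (j : ℝ))) ≠ 0 := (prod_pos fun j _ => by positivity).ne'
  have : (n : ℝ) + s ≠ 0 := by positivity
  rw [add_comm s (n : ℝ)]
  field_simp

lemma inv_natCast_add_isBigO (c : ℝ) :
    (fun n : ℕ => ((n : ℝ) + c)⁻¹) =O[atTop] fun n : ℕ => ((n : ℝ))⁻¹ := by
  have h := ((tendsto_natCast_div_natCast_add c).isBigO_one ℝ).mul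
    (isBigO_refl (fun n : ℕ => ((n : ℝ))⁻¹) atTop)
  refine h.congr' ?_ (by simp)
  filter_upwards [eventually_ne_atTop 0, eventually_natCast_add_pos c] with n hn hc
  field_simp

lemma risingCoef_isBigO_of_pos {s : ℝ} (hs : 0 < s) :
    risingCoef s =O[atTop] fun n : ℕ => (n : ℝ) ^ (s - 1) := by
  have h1 : (fun n => (Real.GammaSeq s n)⁻¹) =O[atTop] fun _ => (1 : ℝ) :=
    ((Real.GammaSeq_tendsto_Gamma s).inv₀ (Real.Gamma_pos_of_pos hs).ne').isBigO_one ℝ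
  have h2 := (h1.mul (isBigO_refl (fun n : ℕ => (n : ℝ) ^ s) atTop)).mul (inv_natCast_add_isBigO s)
  refine h2.congr' ?_ ?_
  · filter_upwards [eventually_ne_atTop 0] with n hn
    have := (risingCoef_pos hs n).ne'
    have : 0 < (n : ℝ) ^ s := by positivity
    rw [GammaSeq_eq_risingCoef hs]
    field_simp
  · filter_upwards [eventually_ne_atTop 0] with n hn
    rw [Real.rpow_sub_one (by positivity)]
    ring

lemma risingCoef_isBigO (s : ℝ) :
    risingCoef s =O[atTop] fun n : ℕ => (n : ℝ) ^ (s - 1) := by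
  suffices ∀ k : ℕ, ∀ s : ℝ, 0 < s + k →
      risingCoef s =O[atTop] fun n : ℕ => (n : ℝ) ^ (s - 1) by
    obtain ⟨k, hk⟩ := exists_nat_gt (-s)
    exact this k s (by linarith)
  intro k
  induction k with
  | zero => intro s hs; exact risingCoef_isBigO_of_pos (by simpa using hs)
  | succ k ih =>
    intro s hs
    have h := ((ih (s + 1) (by push_cast at hs; linarith)).mul (inv_natCast_add_isBigO s)).const_mul_left s
    refine h.congr' ?_ ?_
    · filter_upwards [eventually_natCast_add_pos s] with n hn
      rw [← mul_assoc, mul_risingCoef_add_one, add_comm s]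
      field_simp
    · filter_upwards [eventually_ne_atTop 0] with n hn
      rw [add_sub_cancel_right, Real.rpow_sub_one (by positivity)]
      ring

lemma isBigO_sub_limit_of_isBigO_step {u : ℕ → ℝ} {L : ℝ} (hu : Tendsto u atTop (𝓝 L))
    (h : (fun n => u (n + 1) - u n) =O[atTop] fun n : ℕ => ((n : ℝ)⁻¹) ^ 3) :
    (fun n => u n - L) =O[atTop] fun n : ℕ => ((n : ℝ)⁻¹) ^ 2 := by
  obtain ⟨C, hC0, hC⟩ := h.exists_pos
  rw [IsBigOWith] at hC
  obtain ⟨N, hN⟩ := eventually_atTop.1 (hC.and (eventually_ge_atTop 1))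
  have hstep : ∀ n ≥ N, ∀ k : ℕ,
      |u (n + k) - u n| ≤ 2 * C * (((n : ℝ)⁻¹) ^ 2 - ((n + k : ℝ)⁻¹) ^ 2) := by
    intro n hn k
    induction k with
    | zero => simp
    | succ k ih =>
      have h1 := (hN (n + k) (by omega)).1
      have hx : (1 : ℝ) ≤ n + k := by exact_mod_cast (hN (n + k) (by omega)).2
      rw [Real.norm_eq_abs, Real.norm_of_nonneg (by positivity)] at h1
      push_cast at h1 ⊢
      rw [← add_assoc, ← add_assoc (n : ℝ)]
      set x : ℝ := n + k with hxdef
      have h2 : (x⁻¹) ^ 3 ≤ 2 * ((x⁻¹) ^ 2 - ((x + 1)⁻¹) ^ 2) := by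
        have : 2 * ((x⁻¹) ^ 2 - ((x + 1)⁻¹) ^ 2) - (x⁻¹) ^ 3 =
            (3 * x ^ 2 - 1) / (x ^ 3 * (x + 1) ^ 2) := by
          field_simp
          ring
        have : 0 ≤ (3 * x ^ 2 - 1) / (x ^ 3 * (x + 1) ^ 2) :=
          div_nonneg (by nlinarith) (by positivity)
        linarith
      have h3 := abs_sub_le (u (n + k + 1)) (u (n + k)) (u n)
      nlinarith [mul_le_mul_of_nonneg_left h2 hC0.le]
  refine IsBigO.of_bound (2 * C) ((eventually_ge_atTop N).mono fun n hn => ?_)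
  have hlim : Tendsto (fun k => |u (n + k) - u n|) atTop (𝓝 |L - u n|) := by
    refine ((Tendsto.sub_const ?_ _).abs)
    simpa only [add_comm n] using (tendsto_add_atTop_iff_nat n).2 hu
  rw [Real.norm_eq_abs, abs_sub_comm, Real.norm_of_nonneg (by positivity)]
  refine le_of_tendsto' hlim fun k => (hstep n hn k).trans ?_
  have : 0 ≤ ((n + k : ℝ)⁻¹) ^ 2 := by positivity
  nlinarith

lemma one_add_rpow_taylor_isBigO (s : ℝ) :
    (fun x : ℝ => (1 + x) ^ s - (1 + s * x + s * (s - 1) / 2 * x ^ 2)) =O[𝓝 0]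
      fun x => x ^ 3 := by
  have h := (Real.one_add_rpow_hasFPowerSeriesAt_zero (a := s)).isBigO_sub_partialSum_pow 3
  refine (h.congr_left fun x => ?_).trans (IsBigO.of_bound 1 (Eventually.of_forall fun x => by simp))
  simp only [FormalMultilinearSeries.partialSum, sum_range_succ, range_zero, sum_empty, zero_add,
    binomialSeries_apply, ← genBinom_eq_choose, List.ofFn_const, List.prod_replicate]
  simp only [genBinom_succ, genBinom_zero, smul_eq_mul]
  push_cast
  ring

/-- The relative increment of `n ^ s / (risingCoef s n * (n - s (s - 1) / 2))` at `x = 1 / n`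
is of third order. -/
lemma ratio_sub_one_isBigO (s : ℝ) :
    (fun x : ℝ => (1 + x) ^ s * ((1 + x) * (1 - s * (s - 1) / 2 * x)) /
        ((1 + s * x) * (1 + x - s * (s - 1) / 2 * x)) - 1) =O[𝓝 0] fun x => x ^ 3 := by
  set c := s * (s - 1) / 2 with hc
  have hbdd : ∀ f : ℝ → ℝ, ContinuousAt f 0 → f =O[𝓝 0] fun _ => (1 : ℝ) :=
    fun f hf => hf.tendsto.isBigO_one ℝ
  have h1 := (one_add_rpow_taylor_isBigO s).mul
    (hbdd (fun x => (1 + x) * (1 - c * x)) (by fun_prop))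
  have h2 : (fun x : ℝ => x ^ 3 * (c * (1 - c) - s * c - c ^ 2 * x)) =O[𝓝 0]
      fun x => x ^ 3 * 1 :=
    (isBigO_refl _ _).mul (hbdd _ (by fun_prop))
  have h3 := (h1.add h2).mul (hbdd (fun x => ((1 + s * x) * (1 + x - c * x))⁻¹)
    (ContinuousAt.inv₀ (by fun_prop) (by simp)))
  simp only [mul_one] at h3
  refine h3.congr' ?_ EventuallyEq.rfl
  have hne : ∀ᶠ x : ℝ in 𝓝 0, (1 + s * x) * (1 + x - c * x) ≠ 0 :=
    ContinuousAt.eventually_ne (by fun_prop) (by simp)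
  filter_upwards [hne] with x hx
  rw [div_sub_one hx, div_eq_mul_inv, hc]
  congr 1
  ring

/-- Two-term expansion of `n ^ s` in terms of the coefficients of `(1 - z) ^ (-s - 1)` and
`(1 - z) ^ (-s)`. -/
lemma rpow_sub_risingCoef_isBigO {s : ℝ} (hs : 0 < s) :
    (fun n : ℕ => (n : ℝ) ^ s - Real.Gamma (s + 1) *
      (risingCoef (s + 1) n - (s + 1) / 2 * risingCoef s n)) =O[atTop]
      fun n : ℕ => (n : ℝ) ^ (s - 2) := by
  set c := s * (s - 1) / 2 with hc
  set T : ℕ → ℝ := fun n => (n : ℝ) ^ s / (risingCoef s n * (n - c)) with hT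
  have hlim : Tendsto T atTop (𝓝 (Real.Gamma s)) := by
    have h1 := ((Real.GammaSeq_tendsto_Gamma s).mul (tendsto_natCast_div_natCast_add (-c))).mul
      ((tendsto_natCast_div_natCast_add s).inv₀ one_ne_zero)
    rw [inv_one, mul_one, mul_one] at h1
    refine h1.congr' ?_
    filter_upwards [eventually_ne_atTop 0, eventually_natCast_add_pos (-c)] with n hn hcn
    have := (risingCoef_pos hs n).ne'
    rw [← sub_eq_add_neg] at hcn ⊢
    rw [GammaSeq_eq_risingCoef hs, hT]
    field_simp
  have hinv : Tendsto (fun n : ℕ => ((n : ℝ))⁻¹) atTop (𝓝 0) := tendsto_inv_atTop_nhds_zero_nat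
  have hstep : (fun n => T (n + 1) - T n) =O[atTop] fun n : ℕ => ((n : ℝ)⁻¹) ^ 3 := by
    have h1 := (hlim.isBigO_one ℝ).mul ((ratio_sub_one_isBigO s).comp_tendsto hinv)
    simp only [one_mul] at h1
    refine h1.congr' ?_ EventuallyEq.rfl
    filter_upwards [eventually_ne_atTop 0, eventually_natCast_add_pos (-c),
      eventually_natCast_add_pos (1 - c)] with n hn hcn hcn'
    have h0 := (risingCoef_pos hs n).ne'
    have hn0 : (0 : ℝ) < n := by positivity
    rw [← sub_eq_add_neg] at hcn
    have e1 : ((n + 1 : ℕ) : ℝ) ^ s = (n : ℝ) ^ s * (1 + (n : ℝ)⁻¹) ^ s := by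
      rw [← Real.mul_rpow (by positivity) (by positivity)]
      congr 1
      push_cast
      field_simp
    have e2 : (n : ℝ) + 1 - c ≠ 0 := by linarith
    have e3 : 1 + (n : ℝ)⁻¹ - c * (n : ℝ)⁻¹ = (n + 1 - c) / n := by field_simp
    have e4 : 1 + s * (n : ℝ)⁻¹ = (s + n) / n := by field_simp; ring
    have e5 : 1 - c * (n : ℝ)⁻¹ = (n - c) / n := by field_simp
    have e6 : s + (n : ℝ) ≠ 0 := by positivity
    simp only [hT, Function.comp_apply, e1, risingCoef_succ, ← hc, e3, e4, e5]
    generalize (1 + (n : ℝ)⁻¹) ^ s = q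
    push_cast
    field_simp
  have hdiff := isBigO_sub_limit_of_isBigO_step hlim hstep
  have hlin : (fun n : ℕ => (n : ℝ) - c) =O[atTop] fun n : ℕ => (n : ℝ) := by
    refine IsBigO.sub (isBigO_refl _ _) ?_
    exact (isLittleO_const_left.2 (Or.inr (by
      simpa [Function.comp_def] using tendsto_natCast_atTop_atTop (R := ℝ)))).isBigO
  refine (((risingCoef_isBigO s).mul hlin).mul hdiff).congr' ?_ ?_
  · filter_upwards [eventually_natCast_add_pos (-c)] with n hcn
    rw [← sub_eq_add_neg] at hcn
    have h0 := (risingCoef_pos hs n).ne'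
    have hG : Real.Gamma (s + 1) = s * Real.Gamma s := Real.Gamma_add_one hs.ne'
    have hA := mul_risingCoef_add_one s n
    have : risingCoef s n * (n - c) * T n = (n : ℝ) ^ s := by
      simp only [hT]
      field_simp
    rw [mul_sub, this, hG]
    rw [hc]
    linear_combination Real.Gamma s * hA
  · filter_upwards [eventually_ne_atTop 0] with n hn
    have : s - 2 = s - 1 - 1 := by ring
    rw [this, Real.rpow_sub_one (by positivity) (s - 1)]
    field_simp

/-- Cauchy product of two sequences. -/
noncomputable def cauchyConv (x y : ℕ → ℝ) (n : ℕ) : ℝ :=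
  ∑ p ∈ antidiagonal n, x p.1 * y p.2

lemma rpow_le_of_half_le (a : ℝ) {u N : ℝ} (hN : 0 < N) (h1 : N / 2 ≤ u) (h2 : u ≤ N) :
    u ^ a ≤ 2 ^ |a| * N ^ a := by
  rcases le_total 0 a with ha | ha
  · calc u ^ a ≤ N ^ a := Real.rpow_le_rpow (by linarith) h2 ha
      _ ≤ _ := le_mul_of_one_le_left (by positivity)
        (Real.one_le_rpow one_le_two (abs_nonneg a))
  · calc u ^ a ≤ (N / 2) ^ a := Real.rpow_le_rpow_of_nonpos (by linarith) h1 ha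
      _ = _ := by
        rw [Real.div_rpow hN.le two_pos.le, abs_of_nonpos ha, Real.rpow_neg two_pos.le]
        field_simp

lemma exists_bound_of_isBigO_rpow {x : ℕ → ℝ} {a : ℝ}
    (hx : x =O[atTop] fun n : ℕ => (n : ℝ) ^ a) :
    ∃ C, 0 < C ∧ ∀ n : ℕ, |x n| ≤ C * ((n : ℝ) + 1) ^ a := by
  obtain ⟨C, hC, h⟩ := bound_of_isBigO_nat_atTop (hx.trans (natCast_rpow_isTheta a).isBigO)
  refine ⟨C, hC, fun n => ?_⟩
  have hp : (0 : ℝ) < ((n : ℝ) + 1) ^ a := by positivity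
  have := h (x := n) hp.ne'
  rwa [Real.norm_eq_abs, Real.norm_of_nonneg hp.le] at this

lemma cauchyConv_isBigO {x y : ℕ → ℝ} {a b q : ℝ} {M : ℝ}
    (hx : x =O[atTop] fun n : ℕ => (n : ℝ) ^ a) (hy : y =O[atTop] fun n : ℕ => (n : ℝ) ^ b)
    (h : ∀ n : ℕ, ∑ p ∈ antidiagonal n, ((p.1 : ℝ) + 1) ^ a * ((p.2 : ℝ) + 1) ^ b ≤
      M * ((n : ℝ) + 1) ^ q) :
    cauchyConv x y =O[atTop] fun n : ℕ => (n : ℝ) ^ q := by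
  obtain ⟨C, hC0, hC⟩ := exists_bound_of_isBigO_rpow hx
  obtain ⟨D, hD0, hD⟩ := exists_bound_of_isBigO_rpow hy
  refine IsBigO.trans (IsBigO.of_bound (C * D * M) (Eventually.of_forall fun n => ?_))
    (natCast_rpow_isTheta q).symm.isBigO
  rw [Real.norm_of_nonneg (by positivity : (0 : ℝ) ≤ ((n : ℝ) + 1) ^ q), Real.norm_eq_abs]
  calc |cauchyConv x y n| ≤ ∑ p ∈ antidiagonal n, |x p.1 * y p.2| := abs_sum_le_sum_abs _ _
    _ ≤ ∑ p ∈ antidiagonal n, C * D * (((p.1 : ℝ) + 1) ^ a * ((p.2 : ℝ) + 1) ^ b) := by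
      refine sum_le_sum fun p _ => ?_
      rw [abs_mul]
      calc _ ≤ (C * ((p.1 : ℝ) + 1) ^ a) * (D * ((p.2 : ℝ) + 1) ^ b) :=
            mul_le_mul (hC _) (hD _) (abs_nonneg _) (by positivity)
        _ = _ := by ring
    _ = C * D * ∑ p ∈ antidiagonal n, ((p.1 : ℝ) + 1) ^ a * ((p.2 : ℝ) + 1) ^ b := by
      rw [mul_sum]
    _ ≤ C * D * (M * ((n : ℝ) + 1) ^ q) := by gcongr; exact h n
    _ = _ := by ring

lemma sum_antidiagonal_fst (f : ℕ → ℝ) (n : ℕ) :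
    ∑ p ∈ antidiagonal n, f p.1 = ∑ k ∈ range (n + 1), f k :=
  Nat.sum_antidiagonal_eq_sum_range_succ (fun i _ => f i) n

lemma sum_antidiagonal_snd (f : ℕ → ℝ) (n : ℕ) :
    ∑ p ∈ antidiagonal n, f p.2 = ∑ k ∈ range (n + 1), f k := by
  rw [← sum_antidiagonal_fst f n]
  exact Nat.sum_antidiagonal_swap (f := fun p => f p.1)

lemma cauchyConv_isBigO_of_lt_neg_one {x y : ℕ → ℝ} {a b q : ℝ} (hb : b < -1) (haq : a ≤ q)
    (hbq : b ≤ q) (hx : x =O[atTop] fun n : ℕ => (n : ℝ) ^ a)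
    (hy : y =O[atTop] fun n : ℕ => (n : ℝ) ^ b) :
    cauchyConv x y =O[atTop] fun n : ℕ => (n : ℝ) ^ q := by
  have hs : Summable fun k : ℕ => ((k : ℝ) + 1) ^ b := by
    have := (summable_nat_add_iff 1).2 (Real.summable_nat_rpow.2 hb)
    simpa using this
  set S := ∑' k : ℕ, ((k : ℝ) + 1) ^ b with hS
  have hle : ∀ n, ∑ k ∈ range (n + 1), ((k : ℝ) + 1) ^ b ≤ S := fun n =>
    hs.sum_le_tsum _ fun k _ => by positivity
  refine cauchyConv_isBigO (M := (2 ^ |a| + 2 ^ |b| * 2) * (S + S)) hx hy fun n => ?_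
  have hN1 : (1 : ℝ) ≤ (n : ℝ) + 1 := by simp
  have hN : (0 : ℝ) < (n : ℝ) + 1 := by positivity
  have hterm : ∀ p ∈ antidiagonal n, ((p.1 : ℝ) + 1) ^ a * ((p.2 : ℝ) + 1) ^ b ≤
      (2 ^ |a| + 2 ^ |b| * 2) * ((n : ℝ) + 1) ^ q *
        (((p.1 : ℝ) + 1) ^ b + ((p.2 : ℝ) + 1) ^ b) := by
    intro p hp
    have hpn : (p.1 : ℝ) + p.2 = n := by exact_mod_cast mem_antidiagonal.1 hp
    have h1 : (0 : ℝ) ≤ p.1 := Nat.cast_nonneg _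
    have h2 : (0 : ℝ) ≤ p.2 := Nat.cast_nonneg _
    have haN : ((n : ℝ) + 1) ^ a ≤ ((n : ℝ) + 1) ^ q := Real.rpow_le_rpow_of_exponent_le hN1 haq
    have hbN : ((n : ℝ) + 1) ^ b ≤ ((n : ℝ) + 1) ^ q := Real.rpow_le_rpow_of_exponent_le hN1 hbq
    have hu : (0 : ℝ) ≤ ((p.1 : ℝ) + 1) ^ b := by positivity
    have hv : (0 : ℝ) ≤ ((p.2 : ℝ) + 1) ^ b := by positivity
    have hq : (0 : ℝ) ≤ ((n : ℝ) + 1) ^ q := by positivity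
    rcases le_total (p.2 : ℝ) p.1 with hc | hc
    · calc _ ≤ (2 ^ |a| * ((n : ℝ) + 1) ^ q) * ((p.2 : ℝ) + 1) ^ b := by
            refine mul_le_mul_of_nonneg_right ?_ hv
            refine (rpow_le_of_half_le a hN (by linarith) (by linarith)).trans ?_
            gcongr
        _ ≤ _ := by
            gcongr
            · exact le_add_of_nonneg_right (by positivity)
            · exact le_add_of_nonneg_left hu
    · have hfac : ((p.1 : ℝ) + 1) ^ a * ((n : ℝ) + 1) ^ b ≤
          2 * ((n : ℝ) + 1) ^ q * ((p.1 : ℝ) + 1) ^ b := by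
        rcases le_total a b with hab | hab
        · calc _ ≤ ((p.1 : ℝ) + 1) ^ b * ((n : ℝ) + 1) ^ q := by
                gcongr
                linarith
            _ ≤ _ := by nlinarith [mul_nonneg hu hq]
        · have e1 : ((p.1 : ℝ) + 1) ^ a = ((p.1 : ℝ) + 1) ^ b * ((p.1 : ℝ) + 1) ^ (a - b) := by
            rw [← Real.rpow_add (by positivity)]
            ring_nf
          have e2 : ((n : ℝ) + 1) ^ a = ((n : ℝ) + 1) ^ b * ((n : ℝ) + 1) ^ (a - b) := by
            rw [← Real.rpow_add (by positivity)]
            ring_nf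
          have e3 : ((p.1 : ℝ) + 1) ^ (a - b) ≤ ((n : ℝ) + 1) ^ (a - b) :=
            Real.rpow_le_rpow (by positivity) (by linarith) (by linarith)
          calc _ = ((p.1 : ℝ) + 1) ^ b * (((n : ℝ) + 1) ^ b * ((p.1 : ℝ) + 1) ^ (a - b)) := by
                rw [e1]; ring
            _ ≤ ((p.1 : ℝ) + 1) ^ b * (((n : ℝ) + 1) ^ b * ((n : ℝ) + 1) ^ (a - b)) := by gcongr
            _ ≤ ((p.1 : ℝ) + 1) ^ b * ((n : ℝ) + 1) ^ q := by rw [← e2]; gcongr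
            _ ≤ _ := by nlinarith [mul_nonneg hu hq]
      calc _ ≤ ((p.1 : ℝ) + 1) ^ a * (2 ^ |b| * ((n : ℝ) + 1) ^ b) := by
            refine mul_le_mul_of_nonneg_left ?_ (by positivity)
            exact rpow_le_of_half_le b hN (by linarith) (by linarith)
        _ = 2 ^ |b| * (((p.1 : ℝ) + 1) ^ a * ((n : ℝ) + 1) ^ b) := by ring
        _ ≤ 2 ^ |b| * (2 * ((n : ℝ) + 1) ^ q * ((p.1 : ℝ) + 1) ^ b) := by gcongr
        _ = 2 ^ |b| * 2 * ((n : ℝ) + 1) ^ q * ((p.1 : ℝ) + 1) ^ b := by ring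
        _ ≤ _ := by
            gcongr
            · exact le_add_of_nonneg_left (by positivity)
            · exact le_add_of_nonneg_right hv
  refine (sum_le_sum hterm).trans ?_
  rw [← mul_sum, sum_add_distrib, sum_antidiagonal_fst (fun k => ((k : ℝ) + 1) ^ b),
    sum_antidiagonal_snd (fun k => ((k : ℝ) + 1) ^ b)]
  calc _ ≤ (2 ^ |a| + 2 ^ |b| * 2) * ((n : ℝ) + 1) ^ q * (S + S) := by
        gcongr <;> exact hle n
    _ = _ := by ring

lemma exists_sum_rpow_le {b : ℝ} (hb : -1 < b) :
    ∃ M : ℝ, 0 ≤ M ∧ ∀ n : ℕ,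
      ∑ k ∈ range (n + 1), ((k : ℝ) + 1) ^ b ≤ M * ((n : ℝ) + 1) ^ (b + 1) := by
  rcases le_total 0 b with h0 | h0
  · refine ⟨1, zero_le_one, fun n => ?_⟩
    calc _ ≤ ∑ k ∈ range (n + 1), ((n : ℝ) + 1) ^ b := by
          refine sum_le_sum fun k hk => ?_
          have : (k : ℝ) ≤ n := by exact_mod_cast Nat.lt_succ_iff.1 (mem_range.1 hk)
          gcongr
      _ = _ := by
          rw [Real.rpow_add_one (by positivity)]
          simp
          ring
  · have hb1 : 0 < b + 1 := by linarith
    refine ⟨(b + 1)⁻¹, by positivity, fun n => ?_⟩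
    have hstep : ∀ k : ℕ, ((k : ℝ) + 1) ^ b ≤
        (b + 1)⁻¹ * (((k + 1 : ℕ) : ℝ) ^ (b + 1) - (k : ℝ) ^ (b + 1)) := by
      intro k
      have hk : (0 : ℝ) < (k : ℝ) + 1 := by positivity
      have hk1 : ((k : ℝ) + 1)⁻¹ ≤ 1 := inv_le_one_of_one_le₀ (by simp)
      have hB := rpow_one_add_le_one_add_mul_self (s := -((k : ℝ) + 1)⁻¹) (p := b + 1)
        (by linarith) hb1.le (by linarith)
      have e : (k : ℝ) = (k + 1) * (1 + -((k : ℝ) + 1)⁻¹) := by field_simp; ring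
      have e' : (k : ℝ) ^ (b + 1) =
          ((k : ℝ) + 1) ^ (b + 1) * (1 + -((k : ℝ) + 1)⁻¹) ^ (b + 1) := by
        rw [← Real.mul_rpow hk.le (by linarith), ← e]
      have e2 : ((k : ℝ) + 1) ^ (b + 1) = ((k : ℝ) + 1) ^ b * (k + 1) :=
        Real.rpow_add_one hk.ne' b
      have hle : (k : ℝ) ^ (b + 1) ≤
          ((k : ℝ) + 1) ^ (b + 1) * (1 + (b + 1) * -((k : ℝ) + 1)⁻¹) := by
        rw [e']
        gcongr
      rw [le_inv_mul_iff₀ hb1]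
      push_cast
      have : ((k : ℝ) + 1) ^ (b + 1) * (1 + (b + 1) * -((k : ℝ) + 1)⁻¹) =
          ((k : ℝ) + 1) ^ (b + 1) - (b + 1) * ((k : ℝ) + 1) ^ b := by
        rw [e2]
        field_simp
        ring
      linarith
    refine (sum_le_sum fun k _ => hstep k).trans ?_
    rw [← mul_sum, sum_range_sub (fun k : ℕ => (k : ℝ) ^ (b + 1))]
    push_cast
    rw [Real.zero_rpow hb1.ne', sub_zero]

lemma cauchyConv_isBigO_of_neg_one_lt {x y : ℕ → ℝ} {a b : ℝ} (ha : -1 < a) (hb : -1 < b)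
    (hx : x =O[atTop] fun n : ℕ => (n : ℝ) ^ a) (hy : y =O[atTop] fun n : ℕ => (n : ℝ) ^ b) :
    cauchyConv x y =O[atTop] fun n : ℕ => (n : ℝ) ^ (a + b + 1) := by
  obtain ⟨Ma, hMa, hSa⟩ := exists_sum_rpow_le ha
  obtain ⟨Mb, hMb, hSb⟩ := exists_sum_rpow_le hb
  refine cauchyConv_isBigO (M := 2 ^ |a| * Mb + 2 ^ |b| * Ma) hx hy fun n => ?_
  have hN : (0 : ℝ) < (n : ℝ) + 1 := by positivity
  have hterm : ∀ p ∈ antidiagonal n, ((p.1 : ℝ) + 1) ^ a * ((p.2 : ℝ) + 1) ^ b ≤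
      2 ^ |a| * ((n : ℝ) + 1) ^ a * ((p.2 : ℝ) + 1) ^ b +
        2 ^ |b| * ((n : ℝ) + 1) ^ b * ((p.1 : ℝ) + 1) ^ a := by
    intro p hp
    have hpn : (p.1 : ℝ) + p.2 = n := by exact_mod_cast mem_antidiagonal.1 hp
    have h1 : (0 : ℝ) ≤ p.1 := Nat.cast_nonneg _
    have h2 : (0 : ℝ) ≤ p.2 := Nat.cast_nonneg _
    rcases le_total (p.2 : ℝ) p.1 with hc | hc
    · have := mul_le_mul_of_nonneg_right
        (rpow_le_of_half_le a hN (u := p.1 + 1) (by linarith) (by linarith))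
        (by positivity : (0 : ℝ) ≤ ((p.2 : ℝ) + 1) ^ b)
      have : (0 : ℝ) ≤ 2 ^ |b| * ((n : ℝ) + 1) ^ b * ((p.1 : ℝ) + 1) ^ a := by positivity
      linarith
    · have := mul_le_mul_of_nonneg_right
        (rpow_le_of_half_le b hN (u := p.2 + 1) (by linarith) (by linarith))
        (by positivity : (0 : ℝ) ≤ ((p.1 : ℝ) + 1) ^ a)
      have : (0 : ℝ) ≤ 2 ^ |a| * ((n : ℝ) + 1) ^ a * ((p.2 : ℝ) + 1) ^ b := by positivity
      linarith
  refine (sum_le_sum hterm).trans ?_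
  rw [sum_add_distrib, ← mul_sum, ← mul_sum, sum_antidiagonal_fst (fun k => ((k : ℝ) + 1) ^ a),
    sum_antidiagonal_snd (fun k => ((k : ℝ) + 1) ^ b)]
  calc _ ≤ 2 ^ |a| * ((n : ℝ) + 1) ^ a * (Mb * ((n : ℝ) + 1) ^ (b + 1)) +
        2 ^ |b| * ((n : ℝ) + 1) ^ b * (Ma * ((n : ℝ) + 1) ^ (a + 1)) := by
        gcongr
        · exact hSb n
        · exact hSa n
    _ = _ := by
        rw [Real.rpow_add_one hN.ne', Real.rpow_add_one hN.ne', Real.rpow_add_one hN.ne',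
          Real.rpow_add hN]
        ring

lemma coeff_mul_eq_cauchyConv (A B : PowerSeries ℝ) (n : ℕ) :
    PowerSeries.coeff n (A * B) =
      cauchyConv (fun i => PowerSeries.coeff i A) (fun i => PowerSeries.coeff i B) n :=
  PowerSeries.coeff_mul n A B

lemma halfSumSeries_mul_risingSeries (β s : ℝ) :
    halfSumSeries β * risingSeries s = risingSeries s - PowerSeries.C (β / 2) * risingSeries (s - 1) +
      risingSeries (s - 2) * PowerSeries.mk (halfSumRemainder β) := by
  have e : s - 2 = s - 1 - 1 := by ring
  rw [halfSumSeries_eq, e, ← risingSeries_mul_one_sub (s - 1), ← risingSeries_mul_one_sub s]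
  ring

lemma coeff_halfSumSeries_mul_risingSeries (β s : ℝ) (n : ℕ) :
    PowerSeries.coeff n (halfSumSeries β * risingSeries s) =
      risingCoef s n - β / 2 * risingCoef (s - 1) n +
        cauchyConv (risingCoef (s - 2)) (halfSumRemainder β) n := by
  rw [halfSumSeries_mul_risingSeries, map_add, map_sub, PowerSeries.coeff_C_mul,
    coeff_mul_eq_cauchyConv]
  simp [risingSeries]

lemma natCast_rpow_isBigO_of_le {a b : ℝ} (h : a ≤ b) :
    (fun n : ℕ => (n : ℝ) ^ a) =O[atTop] fun n : ℕ => (n : ℝ) ^ b := by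
  refine IsBigO.of_bound 1 ((eventually_ge_atTop 1).mono fun n hn => ?_)
  rw [Real.norm_of_nonneg (by positivity), Real.norm_of_nonneg (by positivity), one_mul]
  exact Real.rpow_le_rpow_of_exponent_le (by exact_mod_cast hn) h

lemma halfSumRemainder_isBigO {β : ℝ} (hβ0 : 0 < β) (hβ2 : β ≤ 2) :
    halfSumRemainder β =O[atTop] fun n : ℕ => (n : ℝ) ^ (-β - 1) := by
  have h1 : halfSumRemainder β =O[atTop] fun j => risingCoef (-β) (j + 2) := by
    refine IsBigO.of_bound (2 ^ (-β)) (Eventually.of_forall fun j => ?_)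
    rw [Real.norm_eq_abs, Real.norm_eq_abs, risingCoef_eq_genBinom, neg_neg, abs_mul, abs_pow]
    simpa using abs_halfSumRemainder_le hβ2 j
  refine (h1.trans ((risingCoef_isBigO (-β)).comp_tendsto (tendsto_add_atTop_nat 2))).trans ?_
  refine IsBigO.of_bound 1 ((eventually_ge_atTop 1).mono fun n hn => ?_)
  have : (1 : ℝ) ≤ n := by exact_mod_cast hn
  simp only [Function.comp_apply]
  rw [Real.norm_of_nonneg (by positivity), Real.norm_of_nonneg (by positivity), one_mul]
  exact Real.rpow_le_rpow_of_nonpos (by linarith) (by push_cast; linarith) (by linarith)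

lemma cauchyConv_halfSumRemainder_isBigO {β q s : ℝ} (hβ0 : 0 < β) (hβ2 : β ≤ 2)
    (hq : β - 1 ≤ q) (hs : s - 1 ≤ q) :
    cauchyConv (risingCoef s) (halfSumRemainder β) =O[atTop] fun n : ℕ => (n : ℝ) ^ q :=
  cauchyConv_isBigO_of_lt_neg_one (by linarith) hs (by linarith) (risingCoef_isBigO s)
    (halfSumRemainder_isBigO hβ0 hβ2)

lemma omegaCoef_isBigO {β : ℝ} (hβ0 : 0 < β) (hβ2 : β ≤ 2) :
    omegaCoef β =O[atTop] fun n : ℕ => (n : ℝ) ^ (β - 1) := by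
  have h1 := (risingCoef_isBigO (β - 1)).trans
    (natCast_rpow_isBigO_of_le (by linarith : β - 1 - 1 ≤ β - 1))
  refine (((risingCoef_isBigO β).sub (h1.const_mul_left (β / 2))).add
    (cauchyConv_halfSumRemainder_isBigO (s := β - 2) hβ0 hβ2 le_rfl
      (by linarith))).congr_left fun n => ?_
  rw [omegaCoef_eq_coeff hβ0, coeff_halfSumSeries_mul_risingSeries]

/-- The remainder in the two-term expansion of `n ^ s`. -/
noncomputable def powerRemainder (s : ℝ) (n : ℕ) : ℝ :=
  (n : ℝ) ^ s - Real.Gamma (s + 1) * (risingCoef (s + 1) n - (s + 1) / 2 * risingCoef s n)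

lemma powerRemainder_one (n : ℕ) : powerRemainder 1 n = 0 := by
  have h1 : risingCoef 1 n = 1 := by
    induction n with
    | zero => exact risingCoef_zero 1
    | succ n ih =>
      rw [risingCoef_succ, ih, add_comm (1 : ℝ), div_self (by positivity), one_mul]
  have h2 := mul_risingCoef_add_one 1 n
  rw [one_mul, h1] at h2
  rw [powerRemainder, h1, h2, one_add_one_eq_two, Real.Gamma_two, Real.rpow_one]
  ring

lemma cauchyConv_omegaCoef_powerRemainder_isBigO {β s q : ℝ} (hβ0 : 0 < β) (hβ2 : β ≤ 2)
    (hs : 0 < s) (hq : β - 1 ≤ q) (hsq : s + β - 2 ≤ q) :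
    cauchyConv (omegaCoef β) (powerRemainder s) =O[atTop] fun n : ℕ => (n : ℝ) ^ q := by
  have hω := omegaCoef_isBigO hβ0 hβ2
  have hR : powerRemainder s =O[atTop] fun n : ℕ => (n : ℝ) ^ (s - 2) :=
    rpow_sub_risingCoef_isBigO hs
  rcases lt_trichotomy s 1 with h | rfl | h
  · exact cauchyConv_isBigO_of_lt_neg_one (by linarith) hq (by linarith) hω hR
  · refine (isBigO_zero _ _).congr_left fun n => ?_
    simp [cauchyConv, powerRemainder_one]
  · refine (cauchyConv_isBigO_of_neg_one_lt (by linarith) (by linarith) hω hR).trans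
      (natCast_rpow_isBigO_of_le (by linarith))

/-- Local error of the fractional trapezoidal convolution quadrature on a power function. -/
lemma quadrature_error_isBigO {β s q : ℝ} (hβ0 : 0 < β) (hβ2 : β ≤ 2) (hs : 0 < s)
    (hq : β - 1 ≤ q) (hsq : s + β - 2 ≤ q) :
    (fun n : ℕ => Real.Gamma (s + 1) / Real.Gamma (s + 1 + β) * (n : ℝ) ^ (s + β) -
      ∑ k ∈ range (n + 1), omegaCoef β (n - k) * (k : ℝ) ^ s) =O[atTop]
      fun n : ℕ => (n : ℝ) ^ q := by
  have hG : Real.Gamma (s + 1 + β) ≠ 0 := (Real.Gamma_pos_of_pos (by linarith)).ne'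
  have hsum : ∀ n : ℕ, ∑ k ∈ range (n + 1), omegaCoef β (n - k) * (k : ℝ) ^ s =
      Real.Gamma (s + 1) * (PowerSeries.coeff n (halfSumSeries β * risingSeries (s + 1 + β)) -
        (s + 1) / 2 * PowerSeries.coeff n (halfSumSeries β * risingSeries (s + β))) +
      cauchyConv (omegaCoef β) (powerRemainder s) n := by
    intro n
    have hω : PowerSeries.mk (omegaCoef β) = halfSumSeries β * risingSeries β := by
      ext j
      rw [PowerSeries.coeff_mk, omegaCoef_eq_coeff hβ0]
    have hpow : PowerSeries.mk (fun k : ℕ => (k : ℝ) ^ s) =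
        PowerSeries.C (Real.Gamma (s + 1)) *
          (risingSeries (s + 1) - PowerSeries.C ((s + 1) / 2) * risingSeries s) +
        PowerSeries.mk (powerRemainder s) := by
      ext j
      simp [risingSeries, powerRemainder]
    have h1 : ∑ k ∈ range (n + 1), omegaCoef β (n - k) * (k : ℝ) ^ s =
        PowerSeries.coeff n (PowerSeries.mk (fun k : ℕ => (k : ℝ) ^ s) *
          PowerSeries.mk (omegaCoef β)) := by
      rw [PowerSeries.coeff_mul, Nat.sum_antidiagonal_eq_sum_range_succ_mk]
      simp only [PowerSeries.coeff_mk]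
      exact sum_congr rfl fun k _ => mul_comm _ _
    have h2 : cauchyConv (omegaCoef β) (powerRemainder s) n =
        PowerSeries.coeff n (PowerSeries.mk (omegaCoef β) * PowerSeries.mk (powerRemainder s)) := by
      rw [coeff_mul_eq_cauchyConv]
      simp
    have h3 : PowerSeries.mk (fun k : ℕ => (k : ℝ) ^ s) * PowerSeries.mk (omegaCoef β) =
        PowerSeries.C (Real.Gamma (s + 1)) * (halfSumSeries β * risingSeries (s + 1 + β) -
          PowerSeries.C ((s + 1) / 2) * (halfSumSeries β * risingSeries (s + β))) +
        PowerSeries.mk (omegaCoef β) * PowerSeries.mk (powerRemainder s) := by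
      rw [hpow, hω, ← risingSeries_mul (s + 1) β, ← risingSeries_mul s β]
      ring
    rw [h1, h2, h3, map_add, PowerSeries.coeff_C_mul, map_sub, PowerSeries.coeff_C_mul]
  have hR : powerRemainder (s + β) =O[atTop] fun n : ℕ => (n : ℝ) ^ q :=
    (rpow_sub_risingCoef_isBigO (by linarith)).trans (natCast_rpow_isBigO_of_le hsq)
  have hA := (risingCoef_isBigO (s + β - 1)).trans
    (natCast_rpow_isBigO_of_le (by linarith : s + β - 1 - 1 ≤ q))
  have hc1 := cauchyConv_halfSumRemainder_isBigO (s := s + 1 + β - 2) hβ0 hβ2 hq (by linarith)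
  have hc2 := cauchyConv_halfSumRemainder_isBigO (s := s + β - 2) hβ0 hβ2 hq (by linarith)
  have hc3 := cauchyConv_omegaCoef_powerRemainder_isBigO hβ0 hβ2 hs hq hsq
  refine ((((hR.const_mul_left (Real.Gamma (s + 1) / Real.Gamma (s + 1 + β))).sub
    (hc1.const_mul_left (Real.Gamma (s + 1)))).add
    (((hA.const_mul_left (-(β / 2))).add hc2).const_mul_left
      (Real.Gamma (s + 1) * ((s + 1) / 2)))).sub hc3).congr_left fun n => ?_
  have e1 : s + β + 1 = s + 1 + β := by ring
  have e2 : s + 1 + β - 1 = s + β := by ring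
  rw [hsum, coeff_halfSumSeries_mul_risingSeries, coeff_halfSumSeries_mul_risingSeries,
    powerRemainder, e1, e2]
  field_simp
  ring

/-- Lemma 6.2: bound on the starting weights. -/
theorem starting_weights_bound (β : ℝ) (hβ0 : 0 < β) (hβ1 : β < 1)
    (m : ℕ) (hm : 0 < m) (σ : ℕ → ℝ)
    (hmono : StrictMonoOn σ (Set.Icc 1 m)) (hpos : 0 < σ 1) :
    ∃ C : ℝ, 0 < C ∧ ∀ n : ℕ, 1 ≤ n → ∀ W : ℕ → ℝ, IsStartWeights β σ m n W →
      ∀ k ∈ Finset.Icc 1 m,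
        |W k| ≤ C * ((n : ℝ) ^ (σ m + β - 2) + (n : ℝ) ^ (β - 1)) := by
  have hσ0 : ∀ r ∈ Finset.Icc 1 m, 0 < σ r := fun r hr => by
    have hr' := Finset.mem_Icc.1 hr
    exact hpos.trans_le (hmono.monotoneOn ⟨le_rfl, hm⟩ ⟨hr'.1, hr'.2⟩ hr'.1)
  have hσm : ∀ r ∈ Finset.Icc 1 m, σ r ≤ σ m := fun r hr => by
    have hr' := Finset.mem_Icc.1 hr
    exact hmono.monotoneOn ⟨hr'.1, hr'.2⟩ ⟨hm, le_rfl⟩ hr'.2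
  obtain ⟨K, hK0, hK⟩ := exists_bound_of_vandermonde m σ hmono
  set q := max (σ m + β - 2) (β - 1) with hq
  have herr : ∀ r ∈ Finset.Icc 1 m, ∃ C : ℝ, 0 < C ∧ ∀ n : ℕ, 1 ≤ n →
      |Real.Gamma (σ r + 1) / Real.Gamma (σ r + 1 + β) * (n : ℝ) ^ (σ r + β) -
        ∑ k ∈ Finset.range (n + 1), omegaCoef β (n - k) * (k : ℝ) ^ (σ r)| ≤
        C * (n : ℝ) ^ q := fun r hr => by
    obtain ⟨C, hC0, hC⟩ := bound_of_isBigO_nat_atTop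
      (quadrature_error_isBigO (q := q) hβ0 (by linarith) (hσ0 r hr) (le_max_right _ _)
        ((by linarith [hσm r hr] : σ r + β - 2 ≤ σ m + β - 2).trans (le_max_left _ _)))
    refine ⟨C, hC0, fun n hn => ?_⟩
    have hp : (0 : ℝ) < (n : ℝ) ^ q := by positivity
    have := hC (x := n) hp.ne'
    rwa [Real.norm_eq_abs, Real.norm_of_nonneg hp.le] at this
  choose! C hC0 hC using herr
  set S := ∑ r ∈ Finset.Icc 1 m, C r with hS
  have hS0 : 0 ≤ S := Finset.sum_nonneg fun r hr => (hC0 r hr).le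
  refine ⟨K * S + 1, by positivity, fun n hn W hW k hk => ?_⟩
  have hqn : (n : ℝ) ^ q ≤ (n : ℝ) ^ (σ m + β - 2) + (n : ℝ) ^ (β - 1) := by
    rcases max_choice (σ m + β - 2) (β - 1) with h | h <;> rw [hq, h]
    · exact le_add_of_nonneg_right (by positivity)
    · exact le_add_of_nonneg_left (by positivity)
  have hn0 : (0 : ℝ) ≤ (n : ℝ) ^ q := by positivity
  have hWk := hK W (S * (n : ℝ) ^ q) (fun r hr => by
    rw [hW r hr]
    refine (hC r hr n hn).trans (mul_le_mul_of_nonneg_right ?_ hn0)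
    exact Finset.single_le_sum (f := C) (fun i hi => (hC0 i hi).le) hr) k hk
  calc |W k| ≤ K * (S * (n : ℝ) ^ q) := hWk
    _ ≤ (K * S + 1) * (n : ℝ) ^ q := by linarith
    _ ≤ _ := by gcongr
end

section
/- Bound on the extrapolation correction weights (equation (2.33)): Let m̃ be a positive integer and let 0<δ_1<δ_2<⋯<δ_{m̃} be strictly increasing positive exponents. For each integer n ≥ 2, let Ŵ_{n,k}^{(f)} (k=1,…,m̃) be the unique solution of the linear system Σ_{k=1}^{m̃} Ŵ_{n,k}^{(f)} k^{δ_r} = n^{δ_r} − 2(n−1)^{δ_r} + (n−2)^{δ_r}, r=1,…,m̃. Then there exists a constant C>0, independent of n, such that |Ŵ_{n,k}^{(f)}| ≤ C n^{δ_{m̃}−2} for all n ≥ 2 and all 1 ≤ k ≤ m̃. -/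
/-- `W` solves the Vandermonde system defining the extrapolation correction
weights `Ŵ_{n,k}^{(f)}`, `k = 1,…,m̃`. -/
def IsExtrapWeights (δ : ℕ → ℝ) (m n : ℕ) (W : ℕ → ℝ) : Prop :=
  ∀ r ∈ Finset.Icc 1 m,
    ∑ k ∈ Finset.Icc 1 m, W k * (k : ℝ) ^ (δ r) =
      (n : ℝ) ^ (δ r) - 2 * ((n : ℝ) - 1) ^ (δ r) + ((n : ℝ) - 2) ^ (δ r)

open Finset in
/-- Distinct real exponentials form a Chebyshev system: an exponential sum with `#S` frequencies
that vanishes at `#S` distinct points is trivial. -/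
theorem expSum_coeff_eq_zero (S : Finset ℝ) :
    ∀ (c : ℝ → ℝ) (x : ℕ → ℝ), StrictMono x →
      (∀ i < S.card, ∑ a ∈ S, c a * Real.exp (a * x i) = 0) → ∀ a ∈ S, c a = 0 := by
  induction S using Finset.induction_on with
  | empty => simp
  | insert b S hb ih =>
    intro c x hx hzero
    rw [card_insert_of_notMem hb] at hzero
    let f : ℝ → ℝ := fun t => ∑ a ∈ insert b S, c a * Real.exp ((a - b) * t)
    let f' : ℝ → ℝ := fun t => ∑ a ∈ insert b S, c a * (Real.exp ((a - b) * t) * (a - b))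
    have hf : ∀ t, HasDerivAt f (f' t) t := by
      intro t
      refine HasDerivAt.fun_sum fun a _ => ?_
      have h := ((hasDerivAt_id t).const_mul (a - b)).exp.const_mul (c a)
      simpa using h
    have hfx : ∀ i < S.card + 1, f (x i) = 0 := by
      intro i hi
      have h : f (x i) = Real.exp (-(b * x i)) * ∑ a ∈ insert b S, c a * Real.exp (a * x i) := by
        rw [mul_sum]
        refine sum_congr rfl fun a _ => ?_
        rw [mul_left_comm, ← Real.exp_add]
        ring_nf
      rw [h, hzero i hi, mul_zero]
    have hy : ∀ i, ∃ y ∈ Set.Ioo (x i) (x (i + 1)), i < S.card → f' y = 0 := by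
      intro i
      have hlt : x i < x (i + 1) := hx (Nat.lt_succ_self i)
      by_cases hi : i < S.card
      · obtain ⟨y, hy, hy0⟩ := exists_hasDerivAt_eq_zero (f := f) (f' := f') hlt
          (fun t _ => (hf t).continuousAt.continuousWithinAt)
          ((hfx i (by omega)).trans (hfx (i + 1) (by omega)).symm) (fun t _ => hf t)
        exact ⟨y, hy, fun _ => hy0⟩
      · obtain ⟨y, hy⟩ := exists_between hlt
        exact ⟨y, hy, fun h => absurd h hi⟩
    choose y hy hy0 using hy
    have hymono : StrictMono y := strictMono_nat_of_lt_succ fun i => (hy i).2.trans (hy (i + 1)).1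
    have hS : ∀ a ∈ S, c a = 0 := by
      intro a ha
      have h := ih (fun a => c a * (a - b)) y hymono (fun i hi => ?_) a ha
      · refine (mul_eq_zero.mp h).resolve_right (sub_ne_zero.mpr ?_)
        rintro rfl
        exact hb ha
      · have h : ∑ a ∈ S, c a * (a - b) * Real.exp (a * y i) = Real.exp (b * y i) * f' (y i) := by
          simp only [f']
          rw [sum_insert hb, sub_self, mul_zero, mul_zero, zero_add, mul_sum]
          refine sum_congr rfl fun a _ => ?_
          have he : Real.exp (a * y i) = Real.exp (b * y i) * Real.exp ((a - b) * y i) := by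
            rw [← Real.exp_add]
            ring_nf
          rw [he]
          ring
        rw [h, hy0 i hi, mul_zero]
    intro a ha
    rcases mem_insert.mp ha with rfl | ha
    · have h := hzero 0 (by omega)
      rw [sum_insert hb, sum_eq_zero fun a ha => by rw [hS a ha, zero_mul], add_zero] at h
      exact (mul_eq_zero.mp h).resolve_right (Real.exp_pos _).ne'
    · exact hS a ha

/-- The generalized Vandermonde matrix `(k ^ δ r)` on the nodes `1, …, m` is invertible. -/
theorem det_rpow_vandermonde_ne_zero (m : ℕ) (δ : ℕ → ℝ)
    (hδ : Set.InjOn δ (Set.Icc 1 m)) :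
    (Matrix.of fun r k : Finset.Icc 1 m => ((k : ℕ) : ℝ) ^ δ r).det ≠ 0 := by
  intro hdet
  obtain ⟨v, hv, hv0⟩ := Matrix.exists_vecMul_eq_zero_iff.mpr hdet
  apply hv
  have hinj : Function.Injective fun r : Finset.Icc 1 m => δ r := fun r s h =>
    Subtype.ext (hδ (Finset.mem_Icc.mp r.2) (Finset.mem_Icc.mp s.2) h)
  let S : Finset ℝ := Finset.univ.map ⟨_, hinj⟩
  let c : ℝ → ℝ := Function.extend (fun r : Finset.Icc 1 m => δ r) v 0
  have hc : ∀ r : Finset.Icc 1 m, c (δ r) = v r := fun r => hinj.extend_apply v 0 r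
  have hlog : StrictMono fun i : ℕ => Real.log (i + 1) := fun i j hij =>
    Real.log_lt_log (by positivity) (by exact_mod_cast Nat.succ_lt_succ hij)
  have hS := expSum_coeff_eq_zero S c _ hlog fun i hi => by
    have hi : i + 1 ∈ Finset.Icc 1 m := by
      simp [S] at hi
      simp
      omega
    have h := congrFun hv0 ⟨i + 1, hi⟩
    simp only [Matrix.vecMul, dotProduct, Matrix.of_apply, Pi.zero_apply] at h
    rw [← h, Finset.sum_map]
    refine Finset.sum_congr rfl fun r _ => ?_
    have hpos : (0 : ℝ) < ((i + 1 : ℕ) : ℝ) := by positivity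
    rw [Function.Embedding.coeFn_mk, hc, Real.rpow_def_of_pos hpos, mul_comm (δ r)]
    push_cast
    rfl
  funext r
  rw [← hc r]
  exact hS _ (Finset.mem_map_of_mem ⟨_, hinj⟩ (Finset.mem_univ r))

/-- The backward second difference of `t ^ a` on the integers is `O(n ^ (a - 2))`. -/
theorem exists_abs_second_diff_rpow_le (a : ℝ) (ha : 0 < a) :
    ∃ C : ℝ, 0 < C ∧ ∀ n : ℕ, 2 ≤ n →
      |(n : ℝ) ^ a - 2 * ((n : ℝ) - 1) ^ a + ((n : ℝ) - 2) ^ a| ≤ C * (n : ℝ) ^ (a - 2) := by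
  refine ⟨12 + |a * (a - 1)| * 3 ^ |a - 2|, by positivity, fun n hn => ?_⟩
  rcases hn.eq_or_lt with rfl | hn
  · have h4 : (2 : ℝ) ^ a = 4 * 2 ^ (a - 2) := by
      rw [Real.rpow_sub two_pos]
      norm_num
      ring
    have h1 : (1 : ℝ) ≤ 2 ^ a := Real.one_le_rpow one_le_two ha.le
    have h0 : (0 : ℝ) ≤ |a * (a - 1)| * 3 ^ |a - 2| * 2 ^ (a - 2) := by positivity
    have hval : ((2 : ℕ) : ℝ) ^ a - 2 * (((2 : ℕ) : ℝ) - 1) ^ a + (((2 : ℕ) : ℝ) - 2) ^ a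
        = 2 ^ a - 2 := by
      norm_num [Real.zero_rpow ha.ne']
    rw [hval, abs_le, Nat.cast_ofNat]
    constructor <;> nlinarith
  · have hn3 : (3 : ℝ) ≤ n := by exact_mod_cast hn
    have hd : ∀ p t : ℝ, 0 < t →
        HasDerivAt (fun s : ℝ => (s + 1) ^ p - s ^ p) (p * (t + 1) ^ (p - 1) - p * t ^ (p - 1)) t := by
      intro p t ht
      have h1 := ((hasDerivAt_id t).add_const 1).rpow_const (p := p) (Or.inl (by simp; linarith))
      have h2 := Real.hasDerivAt_rpow_const (x := t) (p := p) (Or.inl ht.ne')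
      simpa using h1.fun_sub h2
    obtain ⟨ξ, hξ, hξe⟩ := exists_hasDerivAt_eq_slope (fun s : ℝ => (s + 1) ^ a - s ^ a)
      (fun t => a * (t + 1) ^ (a - 1) - a * t ^ (a - 1)) (a := (n : ℝ) - 2) (b := n - 1)
      (by linarith)
      (fun t ht => (hd a t (by linarith [ht.1])).continuousAt.continuousWithinAt)
      (fun t ht => hd a t (by linarith [ht.1]))
    have hξ0 : 0 < ξ := by linarith [hξ.1]
    obtain ⟨η, hη, hηe⟩ := exists_hasDerivAt_eq_slope (fun s : ℝ => s ^ (a - 1))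
      (fun t => (a - 1) * t ^ (a - 1 - 1)) (a := ξ) (b := ξ + 1) (by linarith)
      (fun t ht => (Real.hasDerivAt_rpow_const
        (Or.inl (by linarith [ht.1] : 0 < t).ne')).continuousAt.continuousWithinAt)
      (fun t ht => Real.hasDerivAt_rpow_const (Or.inl (by linarith [ht.1] : 0 < t).ne'))
    have hη0 : 0 < η := by linarith [hη.1]
    have e1 : (n : ℝ) - 2 + 1 = n - 1 := by ring
    have e2 : (n : ℝ) - 1 - (n - 2) = 1 := by ring
    have e3 : a - 1 - 1 = a - 2 := by ring
    simp only [e1, e2, div_one, sub_add_cancel] at hξe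
    simp only [e3, add_sub_cancel_left, div_one] at hηe
    have hdiff : (n : ℝ) ^ a - 2 * ((n : ℝ) - 1) ^ a + ((n : ℝ) - 2) ^ a
        = a * (a - 1) * η ^ (a - 2) := by
      linear_combination -hξe - a * hηe
    have hηn : η ^ (a - 2) ≤ 3 ^ |a - 2| * (n : ℝ) ^ (a - 2) := by
      have hle : η ≤ n := by linarith [hη.2, hξ.2]
      have hge : (n : ℝ) ≤ 3 * η := by linarith [hη.1, hξ.1]
      rcases le_total 0 (a - 2) with h | h
      · calc η ^ (a - 2) ≤ (n : ℝ) ^ (a - 2) := Real.rpow_le_rpow hη0.le hle h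
          _ ≤ 3 ^ |a - 2| * (n : ℝ) ^ (a - 2) :=
            le_mul_of_one_le_left (by positivity)
              (Real.one_le_rpow (by norm_num) (abs_nonneg _))
      · have h3 := Real.rpow_le_rpow_of_nonpos (by linarith) hge h
        rw [Real.mul_rpow (by norm_num) hη0.le] at h3
        calc η ^ (a - 2) = 3 ^ |a - 2| * (3 ^ (a - 2) * η ^ (a - 2)) := by
              rw [← mul_assoc, ← Real.rpow_add (by norm_num), abs_of_nonpos h]
              simp
          _ ≤ _ := by gcongr
    rw [hdiff, abs_mul, abs_of_pos (Real.rpow_pos_of_pos hη0 _)]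
    have hnpos : 0 < (n : ℝ) ^ (a - 2) := Real.rpow_pos_of_pos (by linarith) _
    calc |a * (a - 1)| * η ^ (a - 2) ≤ |a * (a - 1)| * (3 ^ |a - 2| * (n : ℝ) ^ (a - 2)) := by
          gcongr
      _ ≤ _ := by nlinarith

/-- Equation (2.33): bound on the extrapolation correction weights. -/
theorem extrap_weights_bound (mt : ℕ) (hmt : 0 < mt) (δ : ℕ → ℝ)
    (hmono : StrictMonoOn δ (Set.Icc 1 mt)) (hpos : 0 < δ 1) :
    ∃ C : ℝ, 0 < C ∧ ∀ n : ℕ, 2 ≤ n → ∀ W : ℕ → ℝ, IsExtrapWeights δ mt n W →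
      ∀ k ∈ Finset.Icc 1 mt, |W k| ≤ C * (n : ℝ) ^ (δ mt - 2) := by
  let A : Matrix (Finset.Icc 1 mt) (Finset.Icc 1 mt) ℝ :=
    Matrix.of fun r k => ((k : ℕ) : ℝ) ^ δ r
  have hA : IsUnit A.det := (det_rpow_vandermonde_ne_zero mt δ hmono.injOn).isUnit
  have hδpos : ∀ r : Finset.Icc 1 mt, 0 < δ r := fun r =>
    have hr := Finset.mem_Icc.mp r.2
    hpos.trans_le (hmono.monotoneOn ⟨le_rfl, hmt⟩ hr hr.1)
  choose D hD hDbound using fun r : Finset.Icc 1 mt =>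
    exists_abs_second_diff_rpow_le (δ r) (hδpos r)
  have hnonneg : ∀ k, 0 ≤ ∑ r, |A⁻¹ k r| * D r := fun k =>
    Finset.sum_nonneg fun r _ => mul_nonneg (abs_nonneg _) (hD r).le
  have hle_sum : ∀ k, ∑ r, |A⁻¹ k r| * D r ≤ 1 + ∑ k, ∑ r, |A⁻¹ k r| * D r := fun k => by
    have h := Finset.single_le_sum (fun k _ => hnonneg k) (Finset.mem_univ k)
    linarith
  refine ⟨1 + ∑ k, ∑ r, |A⁻¹ k r| * D r,
    add_pos_of_pos_of_nonneg one_pos (Finset.sum_nonneg fun k _ => hnonneg k),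
    fun n hn W hW k hk => ?_⟩
  have hn1 : (1 : ℝ) ≤ n := by exact_mod_cast (by omega : 1 ≤ n)
  let b : Finset.Icc 1 mt → ℝ := fun r =>
    (n : ℝ) ^ (δ r) - 2 * ((n : ℝ) - 1) ^ (δ r) + ((n : ℝ) - 2) ^ (δ r)
  have hb : ∀ r, |b r| ≤ D r * (n : ℝ) ^ (δ mt - 2) := fun r => by
    have hr := Finset.mem_Icc.mp r.2
    have hle : δ r ≤ δ mt := hmono.monotoneOn hr ⟨hmt, le_rfl⟩ hr.2
    exact (hDbound r n hn).trans (mul_le_mul_of_nonneg_left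
      (Real.rpow_le_rpow_of_exponent_le hn1 (by linarith)) (hD r).le)
  have hsys : A.mulVec (fun k : Finset.Icc 1 mt => W k) = b := by
    funext r
    simp only [Matrix.mulVec, dotProduct, A, Matrix.of_apply, b]
    rw [← hW r r.2, ← Finset.sum_coe_sort (Finset.Icc 1 mt)]
    exact Finset.sum_congr rfl fun k _ => mul_comm _ _
  have hWk : W k = ∑ r, A⁻¹ ⟨k, hk⟩ r * b r := by
    have h : A⁻¹.mulVec b = fun k : Finset.Icc 1 mt => W k := by
      rw [← hsys, Matrix.mulVec_mulVec, Matrix.nonsing_inv_mul _ hA, Matrix.one_mulVec]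
    exact (congrFun h ⟨k, hk⟩).symm
  calc |W k| ≤ ∑ r, |A⁻¹ ⟨k, hk⟩ r| * |b r| := by
        rw [hWk]
        simpa only [abs_mul] using
          Finset.abs_sum_le_sum_abs (fun r => A⁻¹ ⟨k, hk⟩ r * b r) Finset.univ
    _ ≤ ∑ r, |A⁻¹ ⟨k, hk⟩ r| * (D r * (n : ℝ) ^ (δ mt - 2)) := by
        gcongr with r
        exact hb r
    _ = (∑ r, |A⁻¹ ⟨k, hk⟩ r| * D r) * (n : ℝ) ^ (δ mt - 2) := by
        rw [Finset.sum_mul]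
        simp only [mul_assoc]
    _ ≤ _ := by
        gcongr
        exact hle_sum ⟨k, hk⟩
end

section
/- Corrected extrapolation error for finite monomial sums (equations (2.18) and (2.20)): Let m̃ be a positive integer, 0<δ_1<⋯<δ_{m̃}<δ_{m̃+1} strictly increasing positive exponents, and T>0. For each integer n ≥ 2, let Ŵ_{n,k}^{(f)} (k=1,…,m̃) be the unique solution of Σ_{k=1}^{m̃} Ŵ_{n,k}^{(f)} k^{δ_r} = n^{δ_r} − 2(n−1)^{δ_r} + (n−2)^{δ_r}, r=1,…,m̃. Let f(t) = f_0 + Σ_{r=1}^{m̃+1} d_r t^{δ_r} with f_0, d_r ∈ ℝ. Then there exists a constant C>0, depending only on the exponents, the coefficients d_r and T, such that for every h>0 and every integer n ≥ 2 with t_n = nh ≤ T, setting t_k = kh, one has |f(t_n) − [2f(t_{n−1}) − f(t_{n−2}) + Σ_{k=1}^{m̃} Ŵ_{n,k}^{(f)}(f(t_k) − f_0)]| ≤ C h^2 t_n^{δ_{m̃+1}−2}. -/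
/-- A real-exponent sum `∑ c_r x^{e_r}` with distinct exponents having as many positive zeros as
terms is identically zero. -/
theorem coeff_eq_zero_of_sum_rpow_zeros {ι : Type*} [DecidableEq ι] (s : Finset ι) :
    ∀ (e c : ι → ℝ) (x : ℕ → ℝ), Set.InjOn e s → StrictMono x → 0 < x 0 →
      (∀ i < s.card, ∑ r ∈ s, c r * x i ^ e r = 0) → ∀ r ∈ s, c r = 0 := by
  induction s using Finset.induction_on with
  | empty => simp
  | insert a s ha ih =>
    intro e c x he hx hx0 hz
    have hxpos : ∀ i, 0 < x i := fun i => hx0.trans_le (hx.monotone (Nat.zero_le i))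
    rw [Finset.card_insert_of_notMem ha] at hz
    have hne : ∀ r ∈ s, e r - e a ≠ 0 := fun r hr h => by
      have := he (Finset.mem_coe.2 (Finset.mem_insert_of_mem hr))
        (Finset.mem_coe.2 (Finset.mem_insert_self a s)) (sub_eq_zero.1 h)
      exact ha (this ▸ hr)
    let g : ℝ → ℝ := fun t => c a + ∑ r ∈ s, c r * t ^ (e r - e a)
    let g' : ℝ → ℝ := fun t => ∑ r ∈ s, c r * ((e r - e a) * t ^ (e r - e a - 1))
    have hg : ∀ t, 0 < t → HasDerivAt g (g' t) t := fun t ht =>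
      (HasDerivAt.fun_sum fun r _ =>
        (Real.hasDerivAt_rpow_const (Or.inl ht.ne')).const_mul (c r)).const_add (c a)
    have hgz : ∀ i < s.card + 1, g (x i) = 0 := fun i hi => by
      have h := hz i hi
      rw [Finset.sum_insert ha] at h
      have hp := Real.rpow_pos_of_pos (hxpos i) (e a)
      have : g (x i) * x i ^ e a = 0 := by
        rw [← h, add_mul, Finset.sum_mul]
        congr 1
        refine Finset.sum_congr rfl fun r _ => ?_
        rw [mul_assoc, ← Real.rpow_add (hxpos i), sub_add_cancel]
      exact (mul_eq_zero.1 this).resolve_right hp.ne'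
    have hrolle : ∀ i, ∃ y ∈ Set.Ioo (x i) (x (i + 1)), i < s.card → g' y = 0 := fun i => by
      have hlt : x i < x (i + 1) := hx i.lt_succ_self
      by_cases hi : i < s.card
      · obtain ⟨y, hy, h⟩ := exists_hasDerivAt_eq_zero (f := g) (f' := g') hlt
          (fun t ht => (hg t ((hxpos i).trans_le ht.1)).continuousAt.continuousWithinAt)
          ((hgz i (by omega)).trans (hgz (i + 1) (by omega)).symm)
          (fun t ht => hg t ((hxpos i).trans ht.1))
        exact ⟨y, hy, fun _ => h⟩
      · obtain ⟨y, hy⟩ := exists_between hlt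
        exact ⟨y, hy, fun h => absurd h hi⟩
    choose y hy hyz using hrolle
    have hc := ih (fun r => e r - e a - 1) (fun r => c r * (e r - e a)) y
      (fun p hp q hq h => he (by simp_all) (by simp_all) (by simpa using h))
      (strictMono_nat_of_lt_succ fun i => (hy i).2.trans (hy (i + 1)).1)
      (hx0.trans (hy 0).1)
      (fun i hi => by simpa only [g', mul_assoc] using hyz i hi)
    have hcs : ∀ r ∈ s, c r = 0 := fun r hr => (mul_eq_zero.1 (hc r hr)).resolve_right (hne r hr)
    intro r hr
    rcases Finset.mem_insert.1 hr with rfl | hr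
    · have h := hgz 0 (by omega)
      simp only [g] at h
      rwa [Finset.sum_eq_zero fun q hq => by rw [hcs q hq, zero_mul], add_zero] at h
    · exact hcs r hr

/-- Interpolation at `1, …, m` by combinations of powers with distinct exponents. -/
theorem exists_sum_rpow_interpolation (m : ℕ) (δ : ℕ → ℝ)
    (hδ : Set.InjOn δ (Finset.Icc 1 m)) (b : ℕ → ℝ) :
    ∃ c : ℕ → ℝ, ∀ k ∈ Finset.Icc 1 m, ∑ r ∈ Finset.Icc 1 m, c r * (k : ℝ) ^ δ r = b k := by
  classical
  let A : Matrix (Finset.Icc 1 m) (Finset.Icc 1 m) ℝ := fun r k => ((k : ℕ) : ℝ) ^ δ r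
  have hinj : Function.Injective A.vecMulLinear := by
    rw [injective_iff_map_eq_zero]
    intro c hc
    funext r
    refine coeff_eq_zero_of_sum_rpow_zeros Finset.univ (fun r : Finset.Icc 1 m => δ r) c
      (fun i => (i : ℝ) + 1) (fun p _ q _ h => Subtype.ext (hδ p.2 q.2 h))
      (fun p q h => by simpa using h) (by simp) (fun i hi => ?_) r (Finset.mem_univ r)
    have hi' : i + 1 ∈ Finset.Icc 1 m := by
      simp only [Finset.card_univ, Fintype.card_coe, Nat.card_Icc] at hi
      simp only [Finset.mem_Icc]
      omega
    have h : ∑ r : Finset.Icc 1 m, c r * ((i + 1 : ℕ) : ℝ) ^ δ r = 0 := congrFun hc ⟨i + 1, hi'⟩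
    simpa only [Nat.cast_add, Nat.cast_one] using h
  obtain ⟨c, hc⟩ := LinearMap.injective_iff_surjective.1 hinj fun k => b k
  refine ⟨fun r => if hr : r ∈ Finset.Icc 1 m then c ⟨r, hr⟩ else 0, fun k hk => ?_⟩
  rw [← congrFun hc ⟨k, hk⟩, ← Finset.sum_coe_sort]
  exact Finset.sum_congr rfl fun r _ =>
    congrArg (· * (k : ℝ) ^ δ r) (dif_pos r.2)

/-- The backward second difference of `t ^ a` at `t = x`, with unit step. -/
noncomputable def rpowSecondDiff (a x : ℝ) : ℝ := x ^ a - 2 * (x - 1) ^ a + (x - 2) ^ a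

theorem exists_rpowSecondDiff_eq (a x : ℝ) (hx : 2 < x) :
    ∃ ξ ∈ Set.Ioo (x - 2) x, rpowSecondDiff a x = a * (a - 1) * ξ ^ (a - 2) := by
  obtain ⟨s, hs, h₁⟩ := exists_hasDerivAt_eq_slope (fun t : ℝ => (t + 1) ^ a - t ^ a)
    (fun t => a * (t + 1) ^ (a - 1) - a * t ^ (a - 1)) (show x - 2 < x - 1 by linarith)
    (fun t ht => by
      have h0 : 0 < t := by linarith [ht.1]
      exact (((continuousAt_id.add continuousAt_const).rpow_const (Or.inl (by simp; linarith))).sub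
        (continuousAt_id.rpow_const (Or.inl h0.ne'))).continuousWithinAt)
    (fun t ht => by
      have h0 : 0 < t := by linarith [ht.1]
      have h1 : 0 < t + 1 := by linarith
      simpa using (((hasDerivAt_id' t).add_const 1).rpow_const (p := a) (Or.inl h1.ne')).fun_sub
        (Real.hasDerivAt_rpow_const (p := a) (Or.inl h0.ne')))
  have hs0 : 0 < s := by linarith [hs.1]
  obtain ⟨ξ, hξ, h₂⟩ := exists_hasDerivAt_eq_slope (fun t : ℝ => t ^ (a - 1))
    (fun t => (a - 1) * t ^ (a - 1 - 1)) (show s < s + 1 by linarith)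
    (fun t ht => (continuousAt_id.rpow_const
      (Or.inl (hs0.trans_le ht.1).ne')).continuousWithinAt)
    (fun t ht => Real.hasDerivAt_rpow_const (Or.inl (hs0.trans ht.1).ne'))
  refine ⟨ξ, ⟨by linarith [hs.1, hξ.1], by linarith [hs.2, hξ.2]⟩, ?_⟩
  rw [add_sub_cancel_left, div_one, show a - 1 - 1 = a - 2 by ring] at h₂
  rw [show x - 1 - (x - 2) = 1 by ring, div_one, show x - 1 + 1 = x by ring,
    show x - 2 + 1 = x - 1 by ring] at h₁
  rw [rpowSecondDiff, mul_assoc, h₂]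
  linarith

theorem rpow_le_of_mem_Icc_third {u b : ℝ} (hu : u ∈ Set.Icc (1 / 3 : ℝ) 1) :
    u ^ b ≤ 1 + (1 / 3 : ℝ) ^ b := by
  have h0 : (0 : ℝ) < 1 / 3 := by norm_num
  rcases le_total 0 b with hb | hb
  · have := Real.rpow_le_one (h0.le.trans hu.1) hu.2 hb
    linarith [Real.rpow_pos_of_pos h0 b]
  · linarith [Real.rpow_le_rpow_of_nonpos h0 hu.1 hb]

theorem exists_abs_rpowSecondDiff_le (a : ℝ) :
    ∃ K : ℝ, 0 ≤ K ∧ ∀ n : ℕ, 2 ≤ n → |rpowSecondDiff a n| ≤ K * (n : ℝ) ^ (a - 2) := by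
  have h2 : (0 : ℝ) < 2 ^ (a - 2) := Real.rpow_pos_of_pos two_pos _
  have h3 : (0 : ℝ) < (1 / 3) ^ (a - 2) := Real.rpow_pos_of_pos (by norm_num) _
  refine ⟨|rpowSecondDiff a 2| / 2 ^ (a - 2) + |a * (a - 1)| * (1 + (1 / 3 : ℝ) ^ (a - 2)),
    by positivity, fun n hn => ?_⟩
  rw [add_mul]
  rcases hn.eq_or_lt with rfl | hn
  · rw [Nat.cast_ofNat, div_mul_cancel₀ _ h2.ne']
    exact le_add_of_nonneg_right (by positivity)
  · have hn3 : (3 : ℝ) ≤ n := by exact_mod_cast hn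
    have hn0 : (0 : ℝ) < n := by linarith
    obtain ⟨ξ, hξ, h⟩ := exists_rpowSecondDiff_eq a n (by linarith)
    have hξ0 : 0 < ξ := by linarith [hξ.1]
    have hu : ξ / n ∈ Set.Icc (1 / 3 : ℝ) 1 := by
      constructor
      · rw [le_div_iff₀ hn0]; linarith [hξ.1]
      · rw [div_le_one hn0]; exact hξ.2.le
    have hle : ξ ^ (a - 2) ≤ (1 + (1 / 3 : ℝ) ^ (a - 2)) * (n : ℝ) ^ (a - 2) := by
      have := rpow_le_of_mem_Icc_third (b := a - 2) hu
      rwa [Real.div_rpow hξ0.le hn0.le, div_le_iff₀ (Real.rpow_pos_of_pos hn0 _)] at this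
    rw [h, abs_mul, abs_of_pos (Real.rpow_pos_of_pos hξ0 _), mul_assoc |a * (a - 1)|]
    exact (mul_le_mul_of_nonneg_left hle (abs_nonneg _)).trans
      (le_add_of_nonneg_left (by positivity))

/-- Equations (2.18), (2.20): corrected extrapolation error for a finite
monomial sum `f(t) = f₀ + Σ_{r=1}^{m̃+1} d_r t^{δ_r}` on the grid `t_k = kh`. -/
theorem corrected_extrapolation_error (mt : ℕ) (hmt : 0 < mt) (δ : ℕ → ℝ)
    (hmono : StrictMonoOn δ (Set.Icc 1 (mt + 1))) (hpos : 0 < δ 1)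
    (T : ℝ) (hT : 0 < T) (f₀ : ℝ) (d : ℕ → ℝ)
    (F : ℝ → ℝ)
    (hF : ∀ t : ℝ, F t = f₀ + ∑ r ∈ Finset.Icc 1 (mt + 1), d r * t ^ (δ r)) :
    ∃ C : ℝ, 0 < C ∧ ∀ h : ℝ, 0 < h → ∀ n : ℕ, 2 ≤ n → (n : ℝ) * h ≤ T →
      ∀ W : ℕ → ℝ, IsExtrapWeights δ mt n W →
        |F ((n : ℝ) * h) -
            (2 * F (((n : ℝ) - 1) * h) - F (((n : ℝ) - 2) * h) +
              ∑ k ∈ Finset.Icc 1 mt, W k * (F ((k : ℝ) * h) - f₀))| ≤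
          C * h ^ 2 * ((n : ℝ) * h) ^ (δ (mt + 1) - 2) := by
  have hsub : ∀ r ∈ Finset.Icc 1 mt, r ∈ Set.Icc 1 (mt + 1) := fun r hr => by
    simp only [Finset.mem_Icc, Set.mem_Icc] at hr ⊢
    omega
  obtain ⟨c, hc⟩ := exists_sum_rpow_interpolation mt δ
    (fun p hp q hq h => hmono.injOn (hsub p hp) (hsub q hq) h) (fun k => (k : ℝ) ^ δ (mt + 1))
  choose K hK0 hK using exists_abs_rpowSecondDiff_le
  set a := δ (mt + 1) with ha
  let M : ℝ := K a + ∑ r ∈ Finset.Icc 1 mt, |c r| * K (δ r)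
  have hM0 : 0 ≤ M :=
    add_nonneg (hK0 a) (Finset.sum_nonneg fun r _ => mul_nonneg (abs_nonneg _) (hK0 _))
  refine ⟨|d (mt + 1)| * M + 1, by positivity, fun h hh n hn _ W hW => ?_⟩
  have hn2 : (2 : ℝ) ≤ n := by exact_mod_cast hn
  have hn0 : (0 : ℝ) < n := by linarith
  have hWa : ∑ k ∈ Finset.Icc 1 mt, W k * (k : ℝ) ^ a =
      ∑ r ∈ Finset.Icc 1 mt, c r * rpowSecondDiff (δ r) n := by
    calc _ = ∑ k ∈ Finset.Icc 1 mt, ∑ r ∈ Finset.Icc 1 mt, c r * (W k * (k : ℝ) ^ δ r) := by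
          refine Finset.sum_congr rfl fun k hk => ?_
          rw [← hc k hk, Finset.mul_sum]
          exact Finset.sum_congr rfl fun r _ => by ring
      _ = _ := by
          rw [Finset.sum_comm]
          refine Finset.sum_congr rfl fun r hr => ?_
          rw [← Finset.mul_sum, hW r hr, rpowSecondDiff]
  have hbound : |rpowSecondDiff a n - ∑ k ∈ Finset.Icc 1 mt, W k * (k : ℝ) ^ a| ≤
      M * (n : ℝ) ^ (a - 2) := by
    rw [hWa]
    refine (abs_sub _ _).trans ?_
    rw [add_mul, Finset.sum_mul]
    refine add_le_add (hK a n hn) ((Finset.abs_sum_le_sum_abs _ _).trans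
      (Finset.sum_le_sum fun r hr => ?_))
    have hra : δ r ≤ a := hmono.monotoneOn (hsub r hr) (by simp) (hsub r hr).2
    rw [abs_mul, mul_assoc]
    refine mul_le_mul_of_nonneg_left ((hK (δ r) n hn).trans
      (mul_le_mul_of_nonneg_left ?_ (hK0 _))) (abs_nonneg _)
    exact Real.rpow_le_rpow_of_exponent_le (by linarith) (by linarith)
  have herr : F ((n : ℝ) * h) -
      (2 * F (((n : ℝ) - 1) * h) - F (((n : ℝ) - 2) * h) +
        ∑ k ∈ Finset.Icc 1 mt, W k * (F ((k : ℝ) * h) - f₀)) =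
      d (mt + 1) * h ^ a *
        (rpowSecondDiff a n - ∑ k ∈ Finset.Icc 1 mt, W k * (k : ℝ) ^ a) := by
    have hF' : ∀ x : ℝ, 0 ≤ x →
        F (x * h) = f₀ + ∑ r ∈ Finset.Icc 1 (mt + 1), d r * h ^ δ r * x ^ δ r := fun x hx => by
      rw [hF]
      congr 1
      refine Finset.sum_congr rfl fun r _ => ?_
      rw [Real.mul_rpow hx hh.le]
      ring
    have hsum : ∑ k ∈ Finset.Icc 1 mt, W k * (F ((k : ℝ) * h) - f₀) =
        ∑ r ∈ Finset.Icc 1 (mt + 1), d r * h ^ δ r *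
          ∑ k ∈ Finset.Icc 1 mt, W k * (k : ℝ) ^ δ r := by
      simp only [Finset.mul_sum]
      rw [Finset.sum_comm]
      refine Finset.sum_congr rfl fun k _ => ?_
      rw [hF' k k.cast_nonneg, add_sub_cancel_left, Finset.mul_sum]
      exact Finset.sum_congr rfl fun r _ => by ring
    have hall : F ((n : ℝ) * h) -
        (2 * F (((n : ℝ) - 1) * h) - F (((n : ℝ) - 2) * h) +
          ∑ k ∈ Finset.Icc 1 mt, W k * (F ((k : ℝ) * h) - f₀)) =
        ∑ r ∈ Finset.Icc 1 (mt + 1), d r * h ^ δ r *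
          (rpowSecondDiff (δ r) n - ∑ k ∈ Finset.Icc 1 mt, W k * (k : ℝ) ^ δ r) := by
      rw [hsum, hF' n hn0.le, hF' _ (by linarith), hF' _ (by linarith)]
      simp only [rpowSecondDiff, mul_sub, mul_add, Finset.sum_sub_distrib, Finset.sum_add_distrib,
        mul_left_comm _ (2 : ℝ), ← Finset.mul_sum]
      ring
    rw [hall, Finset.sum_Icc_succ_top (by omega), Finset.sum_eq_zero, zero_add]
    intro r hr
    rw [hW r hr, rpowSecondDiff, sub_self, mul_zero]
  have hpow : h ^ a * (n : ℝ) ^ (a - 2) = h ^ 2 * ((n : ℝ) * h) ^ (a - 2) := by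
    rw [Real.mul_rpow hn0.le hh.le, Real.rpow_sub hh, Real.rpow_two]
    field_simp
  have hp : 0 < h ^ 2 * ((n : ℝ) * h) ^ (a - 2) := by positivity
  rw [herr, abs_mul, abs_mul, abs_of_pos (Real.rpow_pos_of_pos hh a)]
  calc _ ≤ |d (mt + 1)| * h ^ a * (M * (n : ℝ) ^ (a - 2)) := by gcongr
    _ = |d (mt + 1)| * M * (h ^ a * (n : ℝ) ^ (a - 2)) := by ring
    _ = |d (mt + 1)| * M * (h ^ 2 * ((n : ℝ) * h) ^ (a - 2)) := by rw [hpow]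
    _ ≤ (|d (mt + 1)| * M + 1) * h ^ 2 * ((n : ℝ) * h) ^ (a - 2) := by linarith
end

section
/- Corrected fractional quadrature error for finite monomial sums (equations (2.12)–(2.13)): Let 0<β<1, T>0, let m be a positive integer, and let 0<σ_1<⋯<σ_m<σ_{m+1} be strictly increasing positive exponents. Let u(t) = u_0 + Σ_{r=1}^{m+1} c_r t^{σ_r} with u_0, c_r ∈ ℝ. Then there exists a constant C>0, depending only on β, the exponents, the coefficients and T, such that for every h>0 and every integer n ≥ 1 with t_n = nh ≤ T, one has |(I_0^β u)(t_n) − I_{h,σ}^{β,n,m} u| ≤ C(h^2 t_n^{σ_{m+1}+β−2} + h^{1+σ_{m+1}} t_n^{β−1}). -/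
/-- Riemann–Liouville fractional integral `(I_0^β g)(t)`. -/
noncomputable def fracInt (β : ℝ) (g : ℝ → ℝ) (t : ℝ) : ℝ :=
  (Real.Gamma β)⁻¹ * ∫ τ in (0 : ℝ)..t, (t - τ) ^ (β - 1) * g τ

/-- `B_n^σ` completing the starting weights. -/
noncomputable def Bweight (β : ℝ) (ω W : ℕ → ℝ) (m n : ℕ) : ℝ :=
  (n : ℝ) ^ β / Real.Gamma (1 + β) - ∑ k ∈ Finset.range (n + 1), ω (n - k) -
    ∑ k ∈ Finset.Icc 1 m, W k

/-- Corrected quadrature operator `I_{h,σ}^{β,n,m}` applied to grid values `g`. -/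
noncomputable def corrQuad (β h : ℝ) (ω W : ℕ → ℝ) (B : ℝ) (m n : ℕ)
    (g : ℕ → ℝ) : ℝ :=
  h ^ β * ∑ k ∈ Finset.range (n + 1), ω (n - k) * g k +
    h ^ β * ∑ k ∈ Finset.Icc 1 m, W k * g k + h ^ β * B * g 0

namespace FracQuad
open PowerSeries Finset Filter Topology

theorem ringChoose_succ (r : ℝ) (k : ℕ) :
    ((k : ℝ) + 1) * Ring.choose r (k + 1) = (r - k) * Ring.choose r k := by
  rw [Ring.choose_eq_smul, Ring.choose_eq_smul, descPochhammer_succ_right]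
  simp [Polynomial.smeval_mul, Polynomial.smeval_sub, Nat.factorial_succ, Polynomial.smeval_natCast]
  field_simp

/-- The power series `(1 - X) ^ (-a)`. -/
noncomputable def oneSubPow (a : ℝ) : PowerSeries ℝ :=
  rescale (-1) (PowerSeries.binomialSeries ℝ (-a))

theorem oneSubPow_add (a b : ℝ) : oneSubPow (a + b) = oneSubPow a * oneSubPow b := by
  rw [oneSubPow, neg_add, binomialSeries_add, map_mul]; rfl

theorem oneSubPow_zero : oneSubPow 0 = 1 := by simp [oneSubPow]

theorem coeff_zero_oneSubPow (a : ℝ) : coeff 0 (oneSubPow a) = 1 := by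
  simp [oneSubPow]

theorem coeff_succ_oneSubPow (a : ℝ) (k : ℕ) :
    coeff (k + 1) (oneSubPow a) = (a + k) / (k + 1) * coeff k (oneSubPow a) := by
  have := ringChoose_succ (-a) k
  simp only [oneSubPow, coeff_rescale, binomialSeries_coeff, smul_eq_mul, mul_one]
  field_simp
  rw [pow_succ]
  linear_combination (-(-1) ^ k) * this

theorem oneSubPow_neg_one : oneSubPow (-1) = 1 - X := by
  have := binomialSeries_nat (R := ℝ) (A := ℝ) 1
  simp only [Nat.cast_one, pow_one] at this
  simp [oneSubPow, this]
  ring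

/-- The power series `((1 + X) / 2) ^ b`. -/
noncomputable def halfOneAddPow (b : ℝ) : PowerSeries ℝ :=
  C ((2 : ℝ) ^ (-b)) * PowerSeries.binomialSeries ℝ b

theorem halfOneAddPow_add_one (b : ℝ) :
    halfOneAddPow (b + 1) = C (1 / 2 : ℝ) * (1 + X) * halfOneAddPow b := by
  have := binomialSeries_nat (R := ℝ) (A := ℝ) 1
  simp only [Nat.cast_one, pow_one] at this
  rw [halfOneAddPow, halfOneAddPow, binomialSeries_add, this, neg_add, Real.rpow_add two_pos,
    Real.rpow_neg_one, map_mul, one_div]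
  ring

theorem coeff_halfOneAddPow (b : ℝ) (k : ℕ) :
    coeff k (halfOneAddPow b) = 2 ^ (-b) * (-1) ^ k * coeff k (oneSubPow (-b)) := by
  simp [halfOneAddPow, oneSubPow, coeff_rescale, ← mul_assoc, mul_assoc _ ((-1 : ℝ) ^ k), ← mul_pow]

theorem coeff_oneSubPow_eq_Gamma {a : ℝ} (ha : 0 < a) (k : ℕ) :
    coeff k (oneSubPow a) = Real.Gamma (a + k) / (Real.Gamma a * k.factorial) := by
  have h0 := (Real.Gamma_pos_of_pos ha).ne'
  induction k with
  | zero => rw [coeff_zero_oneSubPow]; simp [h0]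
  | succ k ih =>
    have : a + (k + 1 : ℕ) = (a + k) + 1 := by push_cast; ring
    rw [coeff_succ_oneSubPow, ih, this, Real.Gamma_add_one (by positivity), Nat.factorial_succ]
    push_cast
    field_simp

theorem genBinom_eq_ringChoose (β : ℝ) (i : ℕ) :
    (∏ j ∈ Finset.range i, (β - (j : ℝ))) / (Nat.factorial i : ℝ) = Ring.choose β i := by
  induction i with
  | zero => simp
  | succ i ih =>
    have := ringChoose_succ β i
    rw [← ih] at this
    rw [Finset.prod_range_succ, Nat.factorial_succ]
    push_cast
    field_simp at this ⊢
    linarith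

/-! ### Growth of coefficients -/

/-- The coefficients of `f` are `O((k + 1) ^ p)`. -/
def CoeffBound (p : ℝ) (f : PowerSeries ℝ) : Prop :=
  ∃ M : ℝ, ∀ k, |coeff k f| ≤ M * ((k : ℝ) + 1) ^ p

namespace CoeffBound

variable {p q : ℝ} {f g : PowerSeries ℝ}

theorem exists_pos (hf : CoeffBound p f) :
    ∃ M : ℝ, 0 < M ∧ ∀ k, |coeff k f| ≤ M * ((k : ℝ) + 1) ^ p := by
  obtain ⟨M, hM⟩ := hf
  refine ⟨|M| + 1, by positivity, fun k => (hM k).trans ?_⟩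
  have : M ≤ |M| + 1 := (le_abs_self M).trans (by linarith)
  gcongr

theorem add (hf : CoeffBound p f) (hg : CoeffBound p g) : CoeffBound p (f + g) := by
  obtain ⟨M, hM⟩ := hf
  obtain ⟨N, hN⟩ := hg
  refine ⟨M + N, fun k => ?_⟩
  rw [map_add, add_mul]
  exact (abs_add_le _ _).trans (add_le_add (hM k) (hN k))

theorem C_mul (c : ℝ) (hf : CoeffBound p f) : CoeffBound p (C c * f) := by
  obtain ⟨M, hM⟩ := hf
  refine ⟨|c| * M, fun k => ?_⟩
  rw [coeff_C_mul, abs_mul, mul_assoc]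
  exact mul_le_mul_of_nonneg_left (hM k) (abs_nonneg c)

theorem neg (hf : CoeffBound p f) : CoeffBound p (-f) := by
  obtain ⟨M, hM⟩ := hf
  exact ⟨M, fun k => by rw [map_neg, abs_neg]; exact hM k⟩

theorem sub (hf : CoeffBound p f) (hg : CoeffBound p g) : CoeffBound p (f - g) := by
  rw [sub_eq_add_neg]; exact hf.add hg.neg

theorem mono (hpq : p ≤ q) (hf : CoeffBound p f) : CoeffBound q f := by
  obtain ⟨M, hM, h⟩ := hf.exists_pos
  refine ⟨M, fun k => (h k).trans ?_⟩
  have : (1 : ℝ) ≤ k + 1 := by linarith [(k.cast_nonneg : (0 : ℝ) ≤ k)]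
  gcongr

theorem rpow_le_of_le_two_mul (p : ℝ) {x y : ℝ} (hx : 0 < x) (hxy : x ≤ y) (hyx : y ≤ 2 * x) :
    x ^ p ≤ 2 ^ |p| * y ^ p := by
  have hy : 0 < y := hx.trans_le hxy
  have h1 : (1 : ℝ) ≤ 2 ^ |p| := Real.one_le_rpow (by norm_num) (abs_nonneg p)
  rcases le_total 0 p with hp | hp
  · have : x ^ p ≤ y ^ p := by gcongr
    nlinarith [Real.rpow_nonneg hy.le p]
  · have h2 : (2 * x) ^ p ≤ y ^ p := Real.rpow_le_rpow_of_nonpos hy hyx hp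
    rw [Real.mul_rpow (by norm_num) hx.le] at h2
    rw [abs_of_nonpos hp]
    calc x ^ p = 2 ^ (-p) * (2 ^ p * x ^ p) := by
          rw [← mul_assoc, ← Real.rpow_add two_pos]; simp
      _ ≤ _ := by gcongr

theorem rpow_le_of_le_two_mul' (p : ℝ) {x y : ℝ} (hx : 0 < x) (hxy : x ≤ y) (hyx : y ≤ 2 * x) :
    y ^ p ≤ 2 ^ |p| * x ^ p := by
  have hy : 0 < y := hx.trans_le hxy
  have := rpow_le_of_le_two_mul (-p) hx hxy hyx
  rw [Real.rpow_neg hx.le, Real.rpow_neg hy.le, abs_neg] at this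
  have h1 := Real.rpow_pos_of_pos hx p
  have h2 := Real.rpow_pos_of_pos hy p
  field_simp at this
  linarith

theorem X_mul (hf : CoeffBound p f) : CoeffBound p (X * f) := by
  obtain ⟨M, hM, h⟩ := hf.exists_pos
  refine ⟨M * 2 ^ |p|, fun k => ?_⟩
  cases k with
  | zero => simp; positivity
  | succ k =>
    rw [coeff_succ_X_mul, mul_assoc]
    refine (h k).trans ?_
    have hk : (0 : ℝ) ≤ k := k.cast_nonneg
    gcongr
    apply rpow_le_of_le_two_mul <;> push_cast <;> linarith

theorem const (p c : ℝ) : CoeffBound p (C c) := by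
  refine ⟨|c|, fun k => ?_⟩
  rw [coeff_C]
  split_ifs with h
  · simp [h]
  · simp; positivity

theorem mul_of_lt_neg_one (hp : p < -1) (hpq : p ≤ q) (hf : CoeffBound p f)
    (hg : CoeffBound q g) : CoeffBound q (f * g) := by
  obtain ⟨M, hM, hf⟩ := hf.exists_pos
  obtain ⟨N, hN, hg⟩ := hg.exists_pos
  have hs : Summable fun k : ℕ => ((k : ℝ) + 1) ^ p := by
    have := (summable_nat_add_iff 1).2 (Real.summable_nat_rpow.2 hp)
    simpa using this
  set S := ∑' k : ℕ, ((k : ℝ) + 1) ^ p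
  have hS (n : ℕ) : ∑ k ∈ range n, ((k : ℝ) + 1) ^ p ≤ S :=
    hs.sum_le_tsum _ fun k _ => by positivity
  have key (i j n : ℕ) (hij : i + j = n) : ((i : ℝ) + 1) ^ p * ((j : ℝ) + 1) ^ q ≤
      2 ^ |q| * ((n : ℝ) + 1) ^ q * (((i : ℝ) + 1) ^ p + ((j : ℝ) + 1) ^ p) := by
    have hi : (0 : ℝ) ≤ i := i.cast_nonneg
    have hj : (0 : ℝ) ≤ j := j.cast_nonneg
    have hn : (n : ℝ) = i + j := by rw [← hij]; push_cast; ring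
    rcases le_total i j with h | h
    · have h' : (i : ℝ) ≤ j := by exact_mod_cast h
      have := rpow_le_of_le_two_mul q (x := (j : ℝ) + 1) (y := n + 1) (by linarith) (by linarith)
        (by linarith)
      calc ((i : ℝ) + 1) ^ p * ((j : ℝ) + 1) ^ q
          ≤ ((i : ℝ) + 1) ^ p * (2 ^ |q| * ((n : ℝ) + 1) ^ q) := by gcongr
        _ = 2 ^ |q| * ((n : ℝ) + 1) ^ q * (((i : ℝ) + 1) ^ p + 0) := by ring
        _ ≤ _ := by gcongr; positivity
    · have h' : (j : ℝ) ≤ i := by exact_mod_cast h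
      have h1 := rpow_le_of_le_two_mul q (x := (i : ℝ) + 1) (y := n + 1) (by linarith) (by linarith)
        (by linarith)
      have h2 : ((i : ℝ) + 1) ^ (p - q) ≤ ((j : ℝ) + 1) ^ (p - q) :=
        Real.rpow_le_rpow_of_nonpos (by linarith) (by linarith) (by linarith)
      calc ((i : ℝ) + 1) ^ p * ((j : ℝ) + 1) ^ q
          = ((i : ℝ) + 1) ^ q * ((i : ℝ) + 1) ^ (p - q) * ((j : ℝ) + 1) ^ q := by
            rw [← Real.rpow_add (by linarith)]; ring_nf
        _ ≤ (2 ^ |q| * ((n : ℝ) + 1) ^ q) * ((j : ℝ) + 1) ^ (p - q) * ((j : ℝ) + 1) ^ q := by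
            gcongr
        _ = 2 ^ |q| * ((n : ℝ) + 1) ^ q * (0 + ((j : ℝ) + 1) ^ p) := by
            rw [mul_assoc _ (((j : ℝ) + 1) ^ (p - q)), ← Real.rpow_add (by linarith)]; ring_nf
        _ ≤ _ := by gcongr; positivity
  refine ⟨M * N * 2 ^ |q| * (S + S), fun n => ?_⟩
  rw [coeff_mul]
  calc |∑ x ∈ antidiagonal n, coeff x.1 f * coeff x.2 g|
      ≤ ∑ x ∈ antidiagonal n, |coeff x.1 f * coeff x.2 g| := abs_sum_le_sum_abs _ _
    _ ≤ ∑ x ∈ antidiagonal n, (M * N * (2 ^ |q| * ((n : ℝ) + 1) ^ q)) *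
          (((x.1 : ℝ) + 1) ^ p + ((x.2 : ℝ) + 1) ^ p) := by
        refine sum_le_sum fun x hx => ?_
        rw [abs_mul]
        calc |coeff x.1 f| * |coeff x.2 g|
            ≤ (M * ((x.1 : ℝ) + 1) ^ p) * (N * ((x.2 : ℝ) + 1) ^ q) :=
              mul_le_mul (hf _) (hg _) (abs_nonneg _) (by positivity)
          _ = M * N * (((x.1 : ℝ) + 1) ^ p * ((x.2 : ℝ) + 1) ^ q) := by ring
          _ ≤ M * N * (2 ^ |q| * ((n : ℝ) + 1) ^ q *
                (((x.1 : ℝ) + 1) ^ p + ((x.2 : ℝ) + 1) ^ p)) :=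
              mul_le_mul_of_nonneg_left (key _ _ n (mem_antidiagonal.1 hx)) (by positivity)
          _ = _ := by ring
    _ = (M * N * (2 ^ |q| * ((n : ℝ) + 1) ^ q)) * (∑ k ∈ range (n + 1), ((k : ℝ) + 1) ^ p +
          ∑ k ∈ range (n + 1), ((k : ℝ) + 1) ^ p) := by
        rw [← mul_sum, sum_add_distrib,
          Nat.sum_antidiagonal_eq_sum_range_succ (fun i _ => ((i : ℝ) + 1) ^ p),
          Nat.sum_antidiagonal_eq_sum_range_succ (fun _ j => ((j : ℝ) + 1) ^ p)]
        congr 2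
        exact sum_range_reflect (fun k : ℕ => ((k : ℝ) + 1) ^ p) (n + 1)
    _ ≤ (M * N * (2 ^ |q| * ((n : ℝ) + 1) ^ q)) * (S + S) := by
        gcongr <;> exact hS _
    _ = _ := by ring

theorem of_forall_one_le {M : ℝ} (h : ∀ k : ℕ, 1 ≤ k → |coeff k f| ≤ M * (k : ℝ) ^ p) :
    CoeffBound p f := by
  refine ⟨|coeff 0 f| + |M| * 2 ^ |p|, fun k => ?_⟩
  rcases Nat.eq_zero_or_pos k with rfl | hk
  · simp; positivity
  have hk' : (1 : ℝ) ≤ k := by exact_mod_cast hk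
  calc |coeff k f| ≤ M * (k : ℝ) ^ p := h k hk
    _ ≤ |M| * (2 ^ |p| * ((k : ℝ) + 1) ^ p) := by
      gcongr
      · exact le_abs_self M
      · apply rpow_le_of_le_two_mul <;> linarith
    _ = (0 + |M| * 2 ^ |p|) * ((k : ℝ) + 1) ^ p := by ring
    _ ≤ _ := by gcongr; positivity

end CoeffBound

theorem coeff_succ_oneSubPow' (a : ℝ) (k : ℕ) :
    coeff (k + 1) (oneSubPow a) = a / (k + 1) * coeff k (oneSubPow (a + 1)) := by
  induction k with
  | zero => rw [coeff_succ_oneSubPow]; simp [coeff_zero_oneSubPow]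
  | succ k ih =>
    rw [coeff_succ_oneSubPow, ih, coeff_succ_oneSubPow (a + 1)]
    push_cast
    field_simp
    ring

theorem coeff_oneSubPow_sub_one {a : ℝ} (ha : 1 < a) (k : ℕ) :
    coeff k (oneSubPow (a - 1)) = (a - 1) / (k + a - 1) * coeff k (oneSubPow a) := by
  have hk : (0 : ℝ) ≤ k := k.cast_nonneg
  have h1 : (k : ℝ) + a - 1 ≠ 0 := by linarith
  have h2 := coeff_succ_oneSubPow (a - 1) k
  rw [coeff_succ_oneSubPow' (a - 1) k, sub_add_cancel] at h2
  field_simp at h2 ⊢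
  linarith

theorem coeff_oneSubPow_pos {a : ℝ} (ha : 0 < a) (k : ℕ) : 0 < coeff k (oneSubPow a) := by
  rw [coeff_oneSubPow_eq_Gamma ha]
  have := Real.Gamma_pos_of_pos ha
  have := Real.Gamma_pos_of_pos (show 0 < a + k by positivity)
  positivity

theorem tendsto_rpow_div_coeff_oneSubPow {a : ℝ} (ha : 0 < a) :
    Tendsto (fun k : ℕ => (k : ℝ) ^ (a - 1) / (Real.Gamma a * coeff k (oneSubPow a))) atTop
      (𝓝 1) := by
  have hG := Real.Gamma_pos_of_pos ha
  have h1 := Real.GammaSeq_tendsto_Gamma a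
  have h2 : Tendsto (fun k : ℕ => 1 + a / (k : ℝ)) atTop (𝓝 (1 + 0)) :=
    tendsto_const_nhds.add (tendsto_const_div_atTop_nhds_zero_nat a)
  have h3 := (h1.mul h2).div_const (Real.Gamma a)
  rw [add_zero, mul_one, div_self hG.ne'] at h3
  refine h3.congr' ?_
  filter_upwards [eventually_ge_atTop 1] with k hk
  have hk' : (0 : ℝ) < k := by exact_mod_cast hk
  have hprod (n : ℕ) : ∏ j ∈ range n, (a + (j : ℝ)) = n.factorial * coeff n (oneSubPow a) := by
    induction n with
    | zero => simp [coeff_zero_oneSubPow]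
    | succ n ih =>
      rw [prod_range_succ, ih, coeff_succ_oneSubPow, Nat.factorial_succ]
      push_cast
      field_simp
  have hc := coeff_oneSubPow_pos ha k
  rw [Real.GammaSeq, prod_range_succ, hprod, Real.rpow_sub_one hk'.ne']
  field_simp
  ring

theorem CoeffBound.oneSubPow (a : ℝ) : CoeffBound (a - 1) (oneSubPow a) := by
  have pos {a : ℝ} (ha : 0 < a) : CoeffBound (a - 1) (FracQuad.oneSubPow a) := by
    have h := (tendsto_rpow_div_coeff_oneSubPow ha).inv₀ one_ne_zero
    obtain ⟨M, hM⟩ := h.bddAbove_range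
    have hG := Real.Gamma_pos_of_pos ha
    refine of_forall_one_le (M := M / Real.Gamma a) fun k hk => ?_
    have hk' : (0 : ℝ) < k := by exact_mod_cast hk
    have := hM ⟨k, rfl⟩
    have hc := coeff_oneSubPow_pos ha k
    have hp := Real.rpow_pos_of_pos hk' (a - 1)
    rw [abs_of_pos hc]
    simp only [inv_div] at this
    rw [div_le_iff₀ hp] at this
    rw [div_mul_eq_mul_div, le_div_iff₀ hG]
    linarith
  have gen (n : ℕ) : ∀ a : ℝ, -(n : ℝ) < a → CoeffBound (a - 1) (FracQuad.oneSubPow a) := by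
    induction n with
    | zero => intro a ha; exact pos (by simpa using ha)
    | succ n ih =>
      intro a ha
      push_cast at ha
      obtain ⟨M, hM⟩ := ih (a + 1) (by linarith)
      refine of_forall_one_le (M := |a| * M) fun k hk => ?_
      obtain ⟨k, rfl⟩ := Nat.exists_eq_succ_of_ne_zero (by omega : k ≠ 0)
      have hk' : (0 : ℝ) < k + 1 := by positivity
      rw [Nat.succ_eq_add_one, coeff_succ_oneSubPow', abs_mul, abs_div, abs_of_pos hk']
      have := hM k
      rw [add_sub_cancel_right] at this
      push_cast
      rw [Real.rpow_sub_one hk'.ne']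
      calc |a| / ((k : ℝ) + 1) * |coeff k (FracQuad.oneSubPow (a + 1))|
          ≤ |a| / ((k : ℝ) + 1) * (M * ((k : ℝ) + 1) ^ a) := by gcongr
        _ = _ := by field_simp
  obtain ⟨n, hn⟩ := exists_nat_gt (-a)
  exact gen n a (by linarith)

theorem exists_rpow_le_coeff_oneSubPow {a : ℝ} (ha : 0 < a) :
    ∃ M : ℝ, 0 < M ∧ ∀ k : ℕ, ((k : ℝ) + 1) ^ (a - 1) ≤ M * coeff k (oneSubPow a) := by
  obtain ⟨M, hM⟩ := (tendsto_rpow_div_coeff_oneSubPow ha).bddAbove_range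
  have hG := Real.Gamma_pos_of_pos ha
  refine ⟨1 + 2 ^ |a - 1| * (|M| * Real.Gamma a), by positivity, fun k => ?_⟩
  rcases Nat.eq_zero_or_pos k with rfl | hk
  · rw [coeff_zero_oneSubPow]; simp; positivity
  have hk' : (1 : ℝ) ≤ k := by exact_mod_cast hk
  have h := hM ⟨k, rfl⟩
  have hc := coeff_oneSubPow_pos ha k
  simp only at h
  rw [div_le_iff₀ (by positivity)] at h
  calc ((k : ℝ) + 1) ^ (a - 1) ≤ 2 ^ |a - 1| * (k : ℝ) ^ (a - 1) := by
        apply CoeffBound.rpow_le_of_le_two_mul' <;> linarith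
    _ ≤ 2 ^ |a - 1| * (|M| * (Real.Gamma a * coeff k (oneSubPow a))) := by
        gcongr
        refine h.trans ?_
        gcongr
        exact le_abs_self M
    _ ≤ _ := by nlinarith

theorem CoeffBound.mul_of_neg_one_lt {p q : ℝ} {f g : PowerSeries ℝ} (hp : -1 < p) (hq : -1 < q)
    (hf : CoeffBound p f) (hg : CoeffBound q g) : CoeffBound (p + q + 1) (f * g) := by
  obtain ⟨M, hM, hf⟩ := hf.exists_pos
  obtain ⟨N, hN, hg⟩ := hg.exists_pos
  obtain ⟨M', hM', hf'⟩ := exists_rpow_le_coeff_oneSubPow (a := p + 1) (by linarith)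
  obtain ⟨N', hN', hg'⟩ := exists_rpow_le_coeff_oneSubPow (a := q + 1) (by linarith)
  obtain ⟨K, hK⟩ := CoeffBound.oneSubPow (p + 1 + (q + 1))
  rw [add_sub_cancel_right] at hf' hg'
  refine ⟨M * M' * (N * N') * K, fun n => ?_⟩
  have hKn := (le_abs_self _).trans (hK n)
  rw [show p + 1 + (q + 1) - 1 = p + q + 1 by ring, oneSubPow_add, coeff_mul] at hKn
  rw [coeff_mul, mul_assoc _ K]
  refine le_trans ?_ (mul_le_mul_of_nonneg_left hKn (by positivity))
  rw [mul_sum]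
  refine (abs_sum_le_sum_abs _ _).trans (sum_le_sum fun x _ => ?_)
  rw [abs_mul]
  have h1 := (hf x.1).trans (mul_le_mul_of_nonneg_left (hf' x.1) hM.le)
  have h2 := (hg x.2).trans (mul_le_mul_of_nonneg_left (hg' x.2) hN.le)
  refine (mul_le_mul h1 h2 (abs_nonneg _) ((abs_nonneg _).trans h1)).trans (le_of_eq (by ring))

/-! ### Second-order expansion of `k ^ (a - 1)` in binomial coefficients -/

theorem exists_abs_one_add_inv_rpow_sub_le (a : ℝ) :
    ∃ M : ℝ, 0 < M ∧ ∀ k : ℕ, 1 ≤ k →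
      |(1 + (k : ℝ)⁻¹) ^ a - (1 + a * (k : ℝ)⁻¹ + a * (a - 1) / 2 * (k : ℝ)⁻¹ ^ 2)| ≤
        M * (k : ℝ)⁻¹ ^ 3 := by
  have h := (Real.one_add_rpow_hasFPowerSeriesAt_zero (a := a)).isBigO_sub_partialSum_pow 3
  have ht : Tendsto (fun k : ℕ => (k : ℝ)⁻¹) atTop (𝓝 0) := tendsto_inv_atTop_nhds_zero_nat
  obtain ⟨M, hM, hb⟩ := Asymptotics.bound_of_isBigO_nat_atTop (h.comp_tendsto ht)
  refine ⟨M, hM, fun k hk => ?_⟩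
  have hk' : (0 : ℝ) < k := by exact_mod_cast hk
  have c1 : Ring.choose a 1 = a := Ring.choose_one_right a
  have c2 : Ring.choose a 2 = a * (a - 1) / 2 := by
    have := ringChoose_succ a 1
    rw [c1] at this
    push_cast at this
    linarith
  have := @hb k (by simp; omega)
  simp only [Function.comp_apply, zero_add, FormalMultilinearSeries.partialSum, sum_range_succ,
    range_zero, sum_empty, binomialSeries_apply, List.ofFn_const, List.prod_replicate, c1, c2,
    Ring.choose_zero_right, smul_eq_mul, pow_zero, pow_one, mul_one, Real.norm_eq_abs, abs_pow,
    abs_inv, Nat.abs_cast] at this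
  exact this

theorem abs_sub_le_of_abs_succ_sub_le {r : ℕ → ℝ} {l M : ℝ} (hM : 0 ≤ M)
    (hr : Tendsto r atTop (𝓝 l))
    (h : ∀ k, 1 ≤ k → |r (k + 1) - r k| ≤ M * (k : ℝ)⁻¹ ^ 3) (k : ℕ) (hk : 1 ≤ k) :
    |r k - l| ≤ 2 * M * (k : ℝ)⁻¹ ^ 2 := by
  have step (j : ℕ) : |r k - r (k + j)| ≤ 2 * M * ((k : ℝ)⁻¹ ^ 2 - ((k + j : ℕ) : ℝ)⁻¹ ^ 2) := by
    induction j with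
    | zero => simp
    | succ j ih =>
      have h1 := h (k + j) (by omega)
      have hx : (1 : ℝ) ≤ ((k + j : ℕ) : ℝ) := by exact_mod_cast (by omega)
      have h2 : ((k + j : ℕ) : ℝ)⁻¹ ^ 3 ≤
          2 * (((k + j : ℕ) : ℝ)⁻¹ ^ 2 - ((k + (j + 1) : ℕ) : ℝ)⁻¹ ^ 2) := by
        rw [← add_assoc, Nat.cast_add_one (k + j)]
        generalize ((k + j : ℕ) : ℝ) = x at hx
        have : 2 * (x⁻¹ ^ 2 - (x + 1)⁻¹ ^ 2) - x⁻¹ ^ 3 =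
            (3 * x ^ 2 - 1) / (x ^ 3 * (x + 1) ^ 2) := by
          field_simp
          ring
        have : 0 ≤ (3 * x ^ 2 - 1) / (x ^ 3 * (x + 1) ^ 2) := by
          apply div_nonneg
          · nlinarith
          · positivity
        linarith
      have h3 := abs_sub_le (r k) (r (k + j)) (r (k + j + 1))
      rw [abs_sub_comm (r (k + j))] at h3
      have h4 := mul_le_mul_of_nonneg_left h2 hM
      rw [← add_assoc] at h4 ⊢
      linarith
  have hlim : Tendsto (fun j => |r k - r (k + j)|) atTop (𝓝 |r k - l|) := by
    have : Tendsto (fun j => r (k + j)) atTop (𝓝 l) := by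
      simpa [add_comm] using (tendsto_add_atTop_iff_nat k).2 hr
    exact (tendsto_const_nhds.sub this).abs
  refine le_of_tendsto' hlim fun j => (step j).trans ?_
  have : (0 : ℝ) ≤ ((k + j : ℕ) : ℝ)⁻¹ ^ 2 := by positivity
  gcongr
  linarith

/-- The sequence `k ^ p` as a power series. -/
noncomputable def rpowSeries (p : ℝ) : PowerSeries ℝ := mk fun k => (k : ℝ) ^ p

theorem coeffBound_oneSubPow_sub_rpowSeries {a : ℝ} (ha : 1 < a) :
    CoeffBound (a - 3) (C (Real.Gamma a) * (oneSubPow a - C (a / 2) * oneSubPow (a - 1)) -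
      rpowSeries (a - 1)) := by
  have ha0 : 0 < a := by linarith
  have hG := Real.Gamma_pos_of_pos ha0
  set κ := a * (a - 1) / 2 with hκ
  set v : ℕ → ℝ := fun k => Real.Gamma a * coeff k (oneSubPow a) / (k : ℝ) ^ (a - 1) with hv
  set ρ : ℕ → ℝ := fun k => 1 - κ / (k + (a - 1)) with hρ
  have hvlim : Tendsto v atTop (𝓝 1) := by
    have := (tendsto_rpow_div_coeff_oneSubPow ha0).inv₀ one_ne_zero
    simpa [hv] using this
  have hρlim : Tendsto ρ atTop (𝓝 1) := by
    have : Tendsto (fun k : ℕ => κ / ((k : ℝ) + (a - 1))) atTop (𝓝 0) :=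
      Tendsto.const_div_atTop (tendsto_atTop_add_const_right _ _ tendsto_natCast_atTop_atTop) κ
    simpa using this.const_sub 1
  obtain ⟨V, hV⟩ := hvlim.bddAbove_range
  obtain ⟨M, hM, hE⟩ := exists_abs_one_add_inv_rpow_sub_le (-a)
  set P := a * (a + 1) / 2 with hP
  set b := a - κ with hb
  set α := P * (b + (a - 1)) - a * b * (a - 1) with hα
  set γ := P * b * (a - 1) with hγ
  have hstep (k : ℕ) (hk : 1 ≤ k) : |ρ (k + 1) * v (k + 1) - ρ k * v k| ≤
      |V| * (|α| + |γ| + (1 + |b|) * M) * (k : ℝ)⁻¹ ^ 3 := by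
    have hk1 : (1 : ℝ) ≤ k := by exact_mod_cast hk
    have hk0 : (0 : ℝ) < k := by linarith
    have hc := coeff_oneSubPow_pos ha0 k
    have hvk : 0 < v k := by simp only [hv]; positivity
    have hvV : v k ≤ |V| := (hV ⟨k, rfl⟩).trans (le_abs_self V)
    set E := (1 + (k : ℝ)⁻¹) ^ (-a) with hEdef
    have hvs : v (k + 1) = v k * ((k + a) / k * E) := by
      have e1 : (1 + (k : ℝ)⁻¹) = (k + 1) / k := by field_simp
      have e2 : ((k : ℝ) + 1) ^ (a - 1) = ((k : ℝ) + 1) ^ a / (k + 1) :=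
        Real.rpow_sub_one (by positivity) a
      have e3 : (k : ℝ) ^ (a - 1) = (k : ℝ) ^ a / k := Real.rpow_sub_one (by positivity) a
      have p1 := Real.rpow_pos_of_pos hk0 a
      have p2 := Real.rpow_pos_of_pos (show (0 : ℝ) < k + 1 by linarith) a
      simp only [hv, hEdef]
      rw [coeff_succ_oneSubPow, e1, Real.rpow_neg (by positivity),
        Real.div_rpow (by positivity) hk0.le]
      push_cast
      rw [e2, e3]
      field_simp
      ring
    have hEk := hE k hk
    set e := E - (1 + -a * (k : ℝ)⁻¹ + -a * (-a - 1) / 2 * (k : ℝ)⁻¹ ^ 2) with he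
    have hEe : E = 1 - a * (k : ℝ)⁻¹ + P * (k : ℝ)⁻¹ ^ 2 + e := by rw [he, hP]; ring
    have hd : 0 < (k : ℝ) + (a - 1) := by linarith
    have hka : 0 < (k : ℝ) + a := by linarith
    have hid : ρ (k + 1) * v (k + 1) - ρ k * v k =
        v k * ((α * k + γ) / (k + (a - 1)) * (k : ℝ)⁻¹ ^ 3 + (k + b) / k * e) := by
      rw [hvs, hEe]
      simp only [hρ]
      push_cast
      rw [show (k : ℝ) + 1 + (a - 1) = k + a by ring]
      rw [hα, hγ, hb, hP, hκ]
      field_simp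
      ring
    have i1 : |(α * k + γ) / (k + (a - 1))| ≤ |α| + |γ| := by
      rw [abs_div, abs_of_pos hd, div_le_iff₀ hd]
      refine (abs_add_le _ _).trans ?_
      rw [abs_mul, abs_of_pos hk0]
      nlinarith [abs_nonneg α, abs_nonneg γ]
    have i2 : |((k : ℝ) + b) / k| ≤ 1 + |b| := by
      rw [abs_div, abs_of_pos hk0, div_le_iff₀ hk0]
      refine (abs_add_le _ _).trans ?_
      rw [abs_of_pos hk0]
      nlinarith [abs_nonneg b]
    rw [hid, abs_mul, abs_of_pos hvk, mul_assoc]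
    refine mul_le_mul hvV ?_ (abs_nonneg _) (abs_nonneg _)
    refine (abs_add_le _ _).trans ?_
    rw [abs_mul, abs_mul, abs_of_pos (show 0 < (k : ℝ)⁻¹ ^ 3 by positivity), add_mul]
    refine add_le_add (by gcongr) ?_
    rw [mul_assoc]
    exact mul_le_mul i2 hEk (abs_nonneg _) (by positivity)
  have hr := abs_sub_le_of_abs_succ_sub_le (r := fun k => ρ k * v k) (by positivity)
    (by simpa using hρlim.mul hvlim) hstep
  refine CoeffBound.of_forall_one_le
    (M := 2 * (|V| * (|α| + |γ| + (1 + |b|) * M))) fun k hk => ?_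
  have hk1 : (1 : ℝ) ≤ k := by exact_mod_cast hk
  have hk0 : (0 : ℝ) < k := by linarith
  have hd : (k : ℝ) + a - 1 ≠ 0 := by linarith
  have hp := Real.rpow_pos_of_pos hk0 (a - 1)
  have hid : coeff k (C (Real.Gamma a) * (oneSubPow a - C (a / 2) * oneSubPow (a - 1)) -
      rpowSeries (a - 1)) = (k : ℝ) ^ (a - 1) * (ρ k * v k - 1) := by
    simp only [map_sub, coeff_C_mul, rpowSeries, coeff_mk, coeff_oneSubPow_sub_one ha, hρ, hv, hκ,
      ← add_sub_assoc]
    field_simp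
  rw [hid, abs_mul, abs_of_pos hp, show a - 3 = a - 1 - (2 : ℕ) by push_cast; ring,
    Real.rpow_sub_natCast hk0.ne']
  calc _ ≤ (k : ℝ) ^ (a - 1) * _ := mul_le_mul_of_nonneg_left (hr k hk) hp.le
    _ = _ := by field_simp

/-! ### Second-order factorization of `((1 + X) / 2) ^ b` at `X = 1` -/

theorem coeffBound_halfOneAddPow (b : ℝ) : CoeffBound (-1 - b) (halfOneAddPow b) := by
  obtain ⟨M, hM⟩ := CoeffBound.oneSubPow (-b)
  refine ⟨|2 ^ (-b)| * M, fun k => ?_⟩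
  rw [coeff_halfOneAddPow, abs_mul, abs_mul, abs_pow, abs_neg, abs_one, one_pow, mul_one, mul_assoc]
  have := hM k
  rw [show -b - 1 = -1 - b by ring] at this
  gcongr

theorem hasSum_coeff_halfOneAddPow {b : ℝ} (hb : 0 < b) :
    HasSum (fun k => coeff k (halfOneAddPow b)) 1 := by
  obtain ⟨M, hM⟩ := coeffBound_halfOneAddPow b
  have hs : Summable fun k => coeff k (halfOneAddPow b) := by
    refine Summable.of_norm_bounded (g := fun k : ℕ => M * ((k : ℝ) + 1) ^ (-1 - b)) ?_ hM
    have := (summable_nat_add_iff 1).2 (Real.summable_nat_rpow.2 (show -1 - b < -1 by linarith))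
    exact (by simpa using this : Summable fun k : ℕ => ((k : ℝ) + 1) ^ (-1 - b)).mul_left M
  have h1 := Real.tendsto_tsum_powerSeries_nhdsWithin_lt hs.hasSum.tendsto_sum_nat
  have h2 : Tendsto (fun x : ℝ => 2 ^ (-b) * (1 + x) ^ b) (𝓝[<] 1) (𝓝 (2 ^ (-b) * (1 + 1) ^ b)) := by
    refine Tendsto.mono_left ?_ nhdsWithin_le_nhds
    refine Tendsto.const_mul _ (Tendsto.rpow_const ?_ (Or.inr hb.le))
    exact tendsto_const_nhds.add tendsto_id
  have h3 : ∀ᶠ x : ℝ in 𝓝[<] 1,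
      ∑' n, coeff n (halfOneAddPow b) * x ^ n = 2 ^ (-b) * (1 + x) ^ b := by
    filter_upwards [Ioo_mem_nhdsLT (show (0 : ℝ) < 1 by norm_num)] with x hx
    have hf := (Real.one_add_rpow_hasFPowerSeriesOnBall_zero (a := b)).hasSum (y := x)
      (by
        rw [Metric.mem_eball, edist_zero_right, Real.enorm_eq_ofReal_abs, ENNReal.ofReal_lt_one,
          abs_of_pos hx.1]
        exact hx.2)
    simp only [binomialSeries_apply, List.ofFn_const, List.prod_replicate, zero_add,
      smul_eq_mul] at hf
    have := (hf.mul_left (2 ^ (-b))).tsum_eq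
    rw [← this]
    simp [halfOneAddPow, mul_assoc]
  have h4 := tendsto_nhds_unique (h2.congr' (h3.mono fun x hx => hx.symm)) h1
  rw [show (1 : ℝ) + 1 = 2 by norm_num, ← Real.rpow_add two_pos, neg_add_cancel,
    Real.rpow_zero] at h4
  rw [h4]
  exact hs.hasSum

theorem hasSum_nat_mul_coeff_halfOneAddPow {b : ℝ} (hb : 1 < b) :
    HasSum (fun k : ℕ => (k : ℝ) * coeff k (halfOneAddPow b)) (b / 2) := by
  rw [← hasSum_nat_add_iff' 1]
  have h := (hasSum_coeff_halfOneAddPow (b := b - 1) (by linarith)).mul_left (b / 2)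
  simp only [sum_range_one, Nat.cast_zero, zero_mul, sub_zero, mul_one] at h ⊢
  refine h.congr_fun fun k => ?_
  rw [coeff_halfOneAddPow, coeff_halfOneAddPow, coeff_succ_oneSubPow',
    show -(b - 1) = -b + 1 by ring, Real.rpow_add_one two_ne_zero, pow_succ]
  push_cast
  field_simp

theorem coeff_oneSubPow_one (k : ℕ) : coeff k (oneSubPow 1) = 1 := by
  rw [coeff_oneSubPow_eq_Gamma one_pos, add_comm, Real.Gamma_nat_eq_factorial]
  simp [Nat.factorial_ne_zero]

theorem coeff_oneSubPow_two (k : ℕ) : coeff k (oneSubPow 2) = k + 1 := by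
  have := coeff_succ_oneSubPow' 1 k
  rw [coeff_oneSubPow_one, show (1 : ℝ) + 1 = 2 by norm_num] at this
  field_simp at this
  linarith

/-- The quotient of `((1 + X) / 2) ^ b - 1 + b / 2 * (1 - X)` by `(1 - X) ^ 2`. -/
noncomputable def halfOneAddPowQuot (b : ℝ) : PowerSeries ℝ :=
  oneSubPow 2 * (halfOneAddPow b - 1 + C (b / 2) * (1 - X))

theorem coeff_halfOneAddPowQuot (b : ℝ) (n : ℕ) :
    coeff n (halfOneAddPowQuot b) =
      ∑ j ∈ range (n + 1), ((n : ℝ) + 1 - j) * coeff j (halfOneAddPow b) - (n + 1 - b / 2) := by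
  have h : halfOneAddPowQuot b =
      halfOneAddPow b * oneSubPow 2 - oneSubPow 2 + C (b / 2) * oneSubPow 1 := by
    have : oneSubPow 1 = oneSubPow 2 * (1 - X) := by
      rw [← oneSubPow_neg_one, ← oneSubPow_add]; norm_num
    rw [halfOneAddPowQuot, this]
    ring
  rw [h, map_add, map_sub, coeff_C_mul, coeff_oneSubPow_one, coeff_oneSubPow_two, coeff_mul,
    Nat.sum_antidiagonal_eq_sum_range_succ
      (fun i j => coeff i (halfOneAddPow b) * coeff j (oneSubPow 2))]
  have : ∑ j ∈ range (n + 1), coeff j (halfOneAddPow b) * coeff (n - j) (oneSubPow 2) =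
      ∑ j ∈ range (n + 1), ((n : ℝ) + 1 - j) * coeff j (halfOneAddPow b) := by
    refine sum_congr rfl fun j hj => ?_
    rw [coeff_oneSubPow_two, Nat.cast_sub (by simpa [Nat.lt_succ_iff] using hj)]
    ring
  rw [this]
  ring

theorem coeffBound_halfOneAddPowQuot_add_two {β : ℝ} (hβ : 0 < β) :
    CoeffBound (-1 - β) (halfOneAddPowQuot (β + 2)) := by
  obtain ⟨M, hM, hY⟩ := (coeffBound_halfOneAddPow (β + 2)).exists_pos
  refine ⟨M, fun n => ?_⟩
  set F : ℕ → ℝ := fun m => ∑ j ∈ range m, ((n : ℝ) + 1 - j) * coeff j (halfOneAddPow (β + 2))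
    with hF
  have hn : (0 : ℝ) < (n : ℝ) + 1 := by positivity
  have hlim : Tendsto F atTop (𝓝 ((n : ℝ) + 1 - (β + 2) / 2)) := by
    have h := ((hasSum_coeff_halfOneAddPow (b := β + 2) (by linarith)).mul_left ((n : ℝ) + 1)).sub
      (hasSum_nat_mul_coeff_halfOneAddPow (b := β + 2) (by linarith))
    simp only [mul_one, ← sub_mul] at h
    exact h.tendsto_sum_nat
  have step (N : ℕ) : |F (n + 1) - F (n + 1 + N)| ≤
      M * ((n : ℝ) + 1) ^ (-β) * (((n : ℝ) + 1)⁻¹ - ((n : ℝ) + 1 + N)⁻¹) := by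
    induction N with
    | zero => simp
    | succ N ih =>
      have hN : (0 : ℝ) ≤ N := N.cast_nonneg
      have h1 : F (n + 1 + (N + 1)) - F (n + 1 + N) =
          -(N : ℝ) * coeff (n + 1 + N) (halfOneAddPow (β + 2)) := by
        simp only [hF]
        rw [← add_assoc, sum_range_succ]
        push_cast
        ring
      set y : ℝ := (n : ℝ) + 1 + N with hy
      have hy0 : 0 < y := by positivity
      have h2 : |F (n + 1 + (N + 1)) - F (n + 1 + N)| ≤
          M * ((n : ℝ) + 1) ^ (-β) * (y⁻¹ - (y + 1)⁻¹) := by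
        rw [h1, abs_mul, abs_neg, abs_of_nonneg hN]
        have h3 := hY (n + 1 + N)
        push_cast at h3
        rw [← hy] at h3
        have h4 : (y + 1) ^ (-1 - (β + 2)) = (y + 1) ^ (-β) / (y + 1) ^ 3 := by
          rw [← Real.rpow_sub_natCast (by positivity)]; congr 1; push_cast; ring
        have h5 : (y + 1) ^ (-β) ≤ ((n : ℝ) + 1) ^ (-β) :=
          Real.rpow_le_rpow_of_nonpos hn (by linarith) (by linarith)
        have h6 : (N : ℝ) / (y + 1) ^ 3 ≤ y⁻¹ - (y + 1)⁻¹ := by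
          have : y⁻¹ - (y + 1)⁻¹ = 1 / (y * (y + 1)) := by field_simp; ring
          rw [this, div_le_div_iff₀ (by positivity) (by positivity)]
          have : (N : ℝ) ≤ y := by linarith
          calc (N : ℝ) * (y * (y + 1)) ≤ y * (y * (y + 1)) := by gcongr
            _ ≤ 1 * (y + 1) ^ 3 := by nlinarith [mul_pos hy0 hy0]
        calc (N : ℝ) * |coeff (n + 1 + N) (halfOneAddPow (β + 2))|
            ≤ N * (M * ((y + 1) ^ (-β) / (y + 1) ^ 3)) := by rw [← h4]; gcongr
          _ = M * (y + 1) ^ (-β) * (N / (y + 1) ^ 3) := by ring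
          _ ≤ _ := by gcongr
      have h7 := abs_sub_le (F (n + 1)) (F (n + 1 + N)) (F (n + 1 + (N + 1)))
      rw [abs_sub_comm (F (n + 1 + N))] at h7
      push_cast
      rw [show (n : ℝ) + 1 + (N + 1) = y + 1 by rw [hy]; ring]
      linarith
  have hlim' : Tendsto (fun N => |F (n + 1) - F (n + 1 + N)|) atTop
      (𝓝 |coeff n (halfOneAddPowQuot (β + 2))|) := by
    rw [coeff_halfOneAddPowQuot]
    have : Tendsto (fun N => F (n + 1 + N)) atTop (𝓝 ((n : ℝ) + 1 - (β + 2) / 2)) := by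
      simpa [add_comm] using (tendsto_add_atTop_iff_nat (n + 1)).2 hlim
    exact (tendsto_const_nhds.sub this).abs
  refine le_of_tendsto' hlim' fun N => (step N).trans ?_
  rw [show -1 - β = -β - 1 by ring, Real.rpow_sub_one hn.ne', div_eq_mul_inv, ← mul_assoc]
  have : (0 : ℝ) ≤ ((n : ℝ) + 1 + N)⁻¹ := by positivity
  gcongr
  linarith

theorem halfOneAddPowQuot_eq (b : ℝ) :
    halfOneAddPowQuot b = (2 - C (1 / 2) * (1 + X)) * (halfOneAddPowQuot (b + 1) - C (b / 4)) +
      C (1 / 4) * (halfOneAddPow b - 1 + C (b / 2) * (1 - X)) := by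
  have hS : oneSubPow 2 * (1 - X) ^ 2 = 1 := by
    rw [← oneSubPow_neg_one, pow_two, ← oneSubPow_add, ← oneSubPow_add, ← oneSubPow_zero]
    norm_num
  set h : PowerSeries ℝ := C (1 / 2) with hh
  set B : PowerSeries ℝ := C b with hB
  have e1 : C (b / 2) = h * B := by rw [hh, hB, ← map_mul]; congr 1; ring
  have e2 : C ((b + 1) / 2) = h * (B + 1) := by
    rw [hh, hB, ← map_one (C (R := ℝ)), ← map_add, ← map_mul]; congr 1; ring
  have e3 : C (b / 4) = h ^ 2 * B := by rw [hh, hB, ← map_pow, ← map_mul]; congr 1; ring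
  have e4 : (C (1 / 4 : ℝ)) = h ^ 2 := by rw [hh, ← map_pow]; congr 1; norm_num
  have e5 : h * 2 = 1 := by
    rw [hh, ← map_ofNat (C (R := ℝ)) 2, ← map_mul, ← map_one (C (R := ℝ))]; congr 1; norm_num
  have e6 : h * (1 + X) = 1 - h * (1 - X) := by linear_combination e5
  rw [halfOneAddPowQuot, halfOneAddPowQuot, halfOneAddPow_add_one, e1, e2, e3, e4, ← hh, e6]
  linear_combination (h ^ 2 * (halfOneAddPow b - 1 + h * B * (1 - X)) -
    (1 + h * (1 - X)) * h ^ 2 * B) * hS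

theorem coeffBound_halfOneAddPowQuot {β : ℝ} (hβ : 0 < β) :
    CoeffBound (-1 - β) (halfOneAddPowQuot β) := by
  have step {b : ℝ} (hb : β ≤ b) (h : CoeffBound (-1 - β) (halfOneAddPowQuot (b + 1))) :
      CoeffBound (-1 - β) (halfOneAddPowQuot b) := by
    have hY : CoeffBound (-1 - β) (halfOneAddPow b) :=
      (coeffBound_halfOneAddPow b).mono (by linarith)
    have one_sub_X (c : ℝ) : CoeffBound (-1 - β) (C c * (1 - X)) := by
      rw [mul_sub, mul_one, mul_comm _ X]
      exact (CoeffBound.const _ c).sub (CoeffBound.const _ c).X_mul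
    have hone : CoeffBound (-1 - β) 1 := by simpa using CoeffBound.const (-1 - β) 1
    set g := halfOneAddPowQuot (b + 1) - C (b / 4) with hg
    have hgb : CoeffBound (-1 - β) g := h.sub (CoeffBound.const _ _)
    have hmul : (2 - C (1 / 2 : ℝ) * (1 + X)) * g = C 2 * g - C (1 / 2) * (g + X * g) := by
      rw [map_ofNat]; ring
    rw [halfOneAddPowQuot_eq, ← hg, hmul]
    exact ((hgb.C_mul 2).sub ((hgb.add hgb.X_mul).C_mul _)).add
      (((hY.sub hone).add (one_sub_X _)).C_mul _)
  refine step le_rfl (step (by linarith) ?_)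
  rw [add_assoc, one_add_one_eq_two]
  exact coeffBound_halfOneAddPowQuot_add_two hβ

theorem halfOneAddPow_eq (b : ℝ) :
    halfOneAddPow b =
      1 - C (b / 2) * oneSubPow (-1) + oneSubPow (-2) * halfOneAddPowQuot b := by
  have hS : oneSubPow (-2) * oneSubPow 2 = 1 := by
    rw [← oneSubPow_add, neg_add_cancel, oneSubPow_zero]
  rw [halfOneAddPowQuot, oneSubPow_neg_one]
  linear_combination -(halfOneAddPow b - 1 + C (b / 2) * (1 - X)) * hS

/-! ### Quadrature remainder for a single power -/

theorem mk_omegaCoef {β : ℝ} (hβ : 0 < β) :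
    PowerSeries.mk (omegaCoef β) = halfOneAddPow β * oneSubPow β := by
  ext n
  rw [coeff_mk, coeff_mul, Nat.sum_antidiagonal_eq_sum_range_succ
    (fun i j => coeff i (halfOneAddPow β) * coeff j (oneSubPow β)), omegaCoef, mul_sum]
  refine sum_congr rfl fun i _ => ?_
  rw [coeff_oneSubPow_eq_Gamma hβ, genBinom, genBinom_eq_ringChoose, halfOneAddPow, coeff_C_mul,
    binomialSeries_coeff, smul_eq_mul]
  ring

theorem coeffBound_omega_mul_rpowSeries_sub {β σ : ℝ} (hβ0 : 0 < β) (hσ : 0 < σ) :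
    CoeffBound (max (σ - 1) 0 + (β - 1)) (PowerSeries.mk (omegaCoef β) * rpowSeries σ -
      C (Real.Gamma (σ + 1) / Real.Gamma (σ + 1 + β)) * rpowSeries (σ + β)) := by
  set δ := max (σ - 1) 0 + (β - 1) with hδ
  set g := Real.Gamma (σ + 1) with hg
  set s := σ + 1 + β with hs
  have hΓ := Real.Gamma_pos_of_pos (show 0 < s by positivity)
  have hδ1 : β - 1 ≤ δ := by rw [hδ]; linarith [le_max_right (σ - 1) 0]
  have hδ2 : σ + β - 2 ≤ δ := by rw [hδ]; linarith [le_max_left (σ - 1) 0]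
  set E₁ := C g * (oneSubPow (σ + 1) - C ((σ + 1) / 2) * oneSubPow σ) - rpowSeries σ with hE₁
  have bE₁ : CoeffBound (σ - 2) E₁ := by
    have := coeffBound_oneSubPow_sub_rpowSeries (a := σ + 1) (by linarith)
    rwa [add_sub_cancel_right, show σ + 1 - 3 = σ - 2 by ring] at this
  set E₂ := C (Real.Gamma s) * (oneSubPow s - C (s / 2) * oneSubPow (s - 1)) -
    rpowSeries (σ + β) with hE₂
  have bE₂ : CoeffBound δ E₂ := by
    have := coeffBound_oneSubPow_sub_rpowSeries (a := s) (by linarith)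
    rw [show s - 3 = σ + β - 2 by rw [hs]; ring] at this
    rw [hE₂, show σ + β = s - 1 by rw [hs]; ring]
    exact this.mono hδ2
  have bω : CoeffBound (β - 1) (PowerSeries.mk (omegaCoef β)) := by
    rw [mk_omegaCoef hβ0]
    exact (coeffBound_halfOneAddPow β).mul_of_lt_neg_one (by linarith) (by linarith)
      (CoeffBound.oneSubPow β)
  have bωE : CoeffBound δ (PowerSeries.mk (omegaCoef β) * E₁) := by
    rcases lt_trichotomy σ 1 with h | h | h
    · rw [mul_comm]
      exact bE₁.mul_of_lt_neg_one (by linarith) (by linarith) (bω.mono hδ1)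
    · have : E₁ = 0 := by
        ext k
        rw [hE₁, hg, h, one_add_one_eq_two, Real.Gamma_two]
        simp [rpowSeries, coeff_oneSubPow_one, coeff_oneSubPow_two]
      rw [this, mul_zero]
      simpa using CoeffBound.const δ 0
    · exact (bω.mul_of_neg_one_lt (by linarith) (by linarith) bE₁).mono (by linarith)
  have bS : CoeffBound δ (oneSubPow (s - 2)) := (CoeffBound.oneSubPow _).mono (by linarith)
  have bSQ : CoeffBound δ (halfOneAddPowQuot β * oneSubPow (s - 2)) :=
    (coeffBound_halfOneAddPowQuot hβ0).mul_of_lt_neg_one (by linarith) (by linarith) bS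
  have e₁ : oneSubPow β * oneSubPow (σ + 1) = oneSubPow s := by
    rw [← oneSubPow_add, hs, add_comm]
  have e₂ : oneSubPow β * oneSubPow σ = oneSubPow (s - 1) := by
    rw [← oneSubPow_add, hs]; congr 1; ring
  have e₃ : oneSubPow (s - 1) = oneSubPow (-1) * oneSubPow s := by
    rw [← oneSubPow_add]; congr 1; ring
  have e₄ : oneSubPow (s - 2) = oneSubPow (-1) * oneSubPow (s - 1) := by
    rw [← oneSubPow_add]; congr 1; ring
  have e₅ : oneSubPow (-2) = oneSubPow (-1) * oneSubPow (-1) := by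
    rw [← oneSubPow_add]; congr 1; norm_num
  have c₁ : (C (s / 2) : PowerSeries ℝ) = C (β / 2) + C ((σ + 1) / 2) := by
    rw [← map_add, hs]; congr 1; ring
  have c₂ : (C (g / Real.Gamma s) * C (Real.Gamma s) : PowerSeries ℝ) = C g := by
    rw [← map_mul, div_mul_cancel₀ _ hΓ.ne']
  have hid : PowerSeries.mk (omegaCoef β) * rpowSeries σ - C (g / Real.Gamma s) * rpowSeries (σ + β) =
      C g * (halfOneAddPowQuot β * oneSubPow (s - 2) +
        C ((σ + 1) / 2) * (C (β / 2) * oneSubPow (s - 2)) -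
        C ((σ + 1) / 2) * (halfOneAddPowQuot β * oneSubPow (s - 2) -
          X * (halfOneAddPowQuot β * oneSubPow (s - 2)))) -
      PowerSeries.mk (omegaCoef β) * E₁ + C (g / Real.Gamma s) * E₂ := by
    have h₁ : rpowSeries σ =
        C g * (oneSubPow (σ + 1) - C ((σ + 1) / 2) * oneSubPow σ) - E₁ := by rw [hE₁]; ring
    have h₂ : rpowSeries (σ + β) =
        C (Real.Gamma s) * (oneSubPow s - C (s / 2) * oneSubPow (s - 1)) - E₂ := by rw [hE₂]; ring
    have hX : (X : PowerSeries ℝ) = 1 - oneSubPow (-1) := by rw [oneSubPow_neg_one]; ring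
    have h₃ : PowerSeries.mk (omegaCoef β) * (oneSubPow (σ + 1) - C ((σ + 1) / 2) * oneSubPow σ) =
        halfOneAddPow β * (oneSubPow s - C ((σ + 1) / 2) * oneSubPow (s - 1)) := by
      rw [mk_omegaCoef hβ0, ← e₁, ← e₂]; ring
    rw [h₁, h₂, mul_sub, mul_left_comm, h₃, mul_sub (C (g / Real.Gamma s)),
      ← mul_assoc (C (g / Real.Gamma s)) (C (Real.Gamma s)), c₂, c₁,
      halfOneAddPow_eq, e₅, hX, e₄, e₃]
    ring
  rw [hid]
  exact ((((bSQ.add ((bS.C_mul _).C_mul _)).sub ((bSQ.sub bSQ.X_mul).C_mul _)).C_mul _).sub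
    bωE).add (bE₂.C_mul _)

theorem exists_abs_quadrature_remainder_le {β σ : ℝ} (hβ0 : 0 < β) (hσ : 0 < σ) :
    ∃ M : ℝ, 0 < M ∧ ∀ n : ℕ, 1 ≤ n →
      |Real.Gamma (σ + 1) / Real.Gamma (σ + 1 + β) * (n : ℝ) ^ (σ + β) -
        ∑ k ∈ range (n + 1), omegaCoef β (n - k) * (k : ℝ) ^ σ| ≤
      M * (n : ℝ) ^ (max (σ - 1) 0 + (β - 1)) := by
  obtain ⟨M, hM, h⟩ := (coeffBound_omega_mul_rpowSeries_sub hβ0 hσ).exists_pos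
  set δ := max (σ - 1) 0 + (β - 1)
  refine ⟨M * 2 ^ |δ|, by positivity, fun n hn => ?_⟩
  have hn' : (1 : ℝ) ≤ n := by exact_mod_cast hn
  have hsum : coeff n (PowerSeries.mk (omegaCoef β) * rpowSeries σ) =
      ∑ k ∈ range (n + 1), omegaCoef β (n - k) * (k : ℝ) ^ σ := by
    rw [mul_comm, coeff_mul, Nat.sum_antidiagonal_eq_sum_range_succ
      (fun i j => coeff i (rpowSeries σ) * coeff j (PowerSeries.mk (omegaCoef β)))]
    simp only [rpowSeries, coeff_mk, mul_comm]
  have := h n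
  rw [map_sub, hsum, coeff_C_mul, rpowSeries, coeff_mk] at this
  rw [abs_sub_comm, mul_assoc]
  refine this.trans (mul_le_mul_of_nonneg_left ?_ hM.le)
  apply CoeffBound.rpow_le_of_le_two_mul' <;> linarith

/-! ### Generalized Vandermonde systems -/

theorem eq_zero_of_sum_mul_rpow_eq_zero (m : ℕ) (σ a x : Fin m → ℝ) (hσ : Function.Injective σ)
    (hx : StrictMono x) (hx0 : ∀ i, 0 < x i) (h : ∀ i, ∑ j, a j * x i ^ σ j = 0) : a = 0 := by
  induction m with
  | zero => exact Subsingleton.elim _ _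
  | succ m ih =>
    set f : ℝ → ℝ := fun t => ∑ j, a j * t ^ (σ j - σ 0) with hf
    have hf0 (i) : f (x i) = 0 := by
      have : f (x i) = (∑ j, a j * x i ^ σ j) * x i ^ (-σ 0) := by
        rw [hf, sum_mul]
        refine sum_congr rfl fun j _ => ?_
        rw [sub_eq_add_neg, Real.rpow_add (hx0 i), mul_assoc]
      rw [this, h, zero_mul]
    have hd {t : ℝ} (ht : 0 < t) : HasDerivAt f
        (∑ j : Fin m, a j.succ * (σ j.succ - σ 0) * t ^ (σ j.succ - σ 0 - 1)) t := by
      have : HasDerivAt f (∑ j, a j * ((σ j - σ 0) * t ^ (σ j - σ 0 - 1))) t :=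
        HasDerivAt.fun_sum fun j _ => (Real.hasDerivAt_rpow_const (Or.inl ht.ne')).const_mul (a j)
      rw [Fin.sum_univ_succ] at this
      simpa [mul_assoc] using this
    have hy (i : Fin m) : ∃ y ∈ Set.Ioo (x i.castSucc) (x i.succ),
        ∑ j : Fin m, a j.succ * (σ j.succ - σ 0) * y ^ (σ j.succ - σ 0 - 1) = 0 := by
      refine exists_hasDerivAt_eq_zero (hx i.castSucc_lt_succ) ?_
        (by rw [hf0, hf0]) fun t ht => hd ((hx0 _).trans ht.1)
      exact fun t ht => (hd ((hx0 _).trans_le ht.1)).continuousAt.continuousWithinAt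
    choose y hy hy0 using hy
    have hz := ih (fun j => σ j.succ - σ 0 - 1) (fun j => a j.succ * (σ j.succ - σ 0)) y
      (fun i j hij => Fin.succ_injective _ (hσ (by simpa using hij)))
      (fun i j hij => (hy i).2.trans_le
        ((hx.monotone (Fin.succ_le_castSucc_iff.2 hij)).trans (hy j).1.le))
      (fun i => (hx0 _).trans (hy i).1) hy0
    have hsucc (j : Fin m) : a j.succ = 0 := by
      have h1 := congrFun hz j
      have h2 : σ j.succ - σ 0 ≠ 0 := sub_ne_zero.2 fun h => Fin.succ_ne_zero j (hσ h)
      simpa [h2] using h1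
    have h0 : a 0 = 0 := by
      have h1 := h 0
      rw [Fin.sum_univ_succ] at h1
      simpa [hsucc, (Real.rpow_pos_of_pos (hx0 0) (σ 0)).ne'] using h1
    ext j
    exact Fin.cases h0 hsucc j

theorem exists_rpow_eq_sum_mul_rpow (m : ℕ) (σ : ℕ → ℝ) (hσ : Set.InjOn σ (Set.Icc 1 m)) (p : ℝ) :
    ∃ l : ℕ → ℝ, ∀ k ∈ Icc 1 m, (k : ℝ) ^ p = ∑ r ∈ Icc 1 m, l r * (k : ℝ) ^ σ r := by
  set A : Matrix (Fin m) (Fin m) ℝ := fun i j => ((i : ℝ) + 1) ^ σ (j + 1) with hA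
  have hinj : Function.Injective A.mulVec := by
    intro v w hvw
    rw [← sub_eq_zero]
    refine eq_zero_of_sum_mul_rpow_eq_zero m (fun j => σ (j + 1)) (v - w) (fun i => (i : ℝ) + 1)
      (fun i j hij => ?_) (fun i j hij => ?_) (fun i => by positivity) fun i => ?_
    · have := hσ ⟨by omega, by omega⟩ ⟨by omega, by omega⟩ hij
      exact Fin.ext (by omega)
    · have : (i : ℝ) < j := by exact_mod_cast hij
      linarith
    · have := congrFun hvw i
      simp only [Matrix.mulVec, dotProduct, hA] at this
      rw [← sub_eq_zero, ← sum_sub_distrib] at this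
      rw [← this]
      exact sum_congr rfl fun j _ => by simp only [Pi.sub_apply]; ring
  obtain ⟨l, hl⟩ := Matrix.mulVec_surjective_iff_isUnit.2 (Matrix.mulVec_injective_iff_isUnit.1 hinj)
    (fun i : Fin m => ((i : ℝ) + 1) ^ p)
  refine ⟨fun r => if h : r - 1 < m then l ⟨r - 1, h⟩ else 0, fun k hk => ?_⟩
  obtain ⟨hk1, hkm⟩ := mem_Icc.1 hk
  have h := congrFun hl ⟨k - 1, by omega⟩
  simp only [Matrix.mulVec, dotProduct, hA, Nat.cast_sub hk1, Nat.cast_one, sub_add_cancel] at h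
  rw [← h, ← Ico_add_one_right_eq_Icc, sum_Ico_eq_sum_range, Nat.add_sub_cancel,
    ← Fin.sum_univ_eq_sum_range (fun i => (if h : 1 + i - 1 < m then l ⟨1 + i - 1, h⟩ else 0) *
      (k : ℝ) ^ σ (1 + i))]
  refine sum_congr rfl fun j _ => ?_
  simp [add_comm, mul_comm]

/-! ### Fractional integrals of powers -/

theorem integral_sub_rpow_mul_rpow {β p t : ℝ} (hβ : 0 < β) (hp : -1 < p) (ht : 0 < t) :
    ∫ τ in (0 : ℝ)..t, (t - τ) ^ (β - 1) * τ ^ p =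
      Real.Gamma β * (Real.Gamma (p + 1) / Real.Gamma (p + 1 + β) * t ^ (p + β)) := by
  have h := Complex.betaIntegral_scaled ((p + 1 : ℝ) : ℂ) (β : ℂ) ht
  rw [Complex.betaIntegral_eq_Gamma_mul_div _ _ (by simpa using by linarith) (by simpa using hβ)]
    at h
  have h2 : ∫ x in (0 : ℝ)..t, (x : ℂ) ^ (((p + 1 : ℝ) : ℂ) - 1) * ((t : ℂ) - x) ^ ((β : ℂ) - 1) =
      ∫ x in (0 : ℝ)..t, (((t - x) ^ (β - 1) * x ^ p : ℝ) : ℂ) := by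
    refine intervalIntegral.integral_congr fun x hx => ?_
    rw [Set.uIcc_of_le ht.le] at hx
    have h1 := hx.1
    have h2 := sub_nonneg.2 hx.2
    rw [Complex.ofReal_mul, Complex.ofReal_cpow h1, Complex.ofReal_cpow h2]
    push_cast
    rw [add_sub_cancel_right, mul_comm]
  rw [h2, intervalIntegral.integral_ofReal, ← Complex.ofReal_add, Complex.Gamma_ofReal,
    Complex.Gamma_ofReal, Complex.Gamma_ofReal, ← Complex.ofReal_one, ← Complex.ofReal_sub,
    ← Complex.ofReal_cpow ht.le] at h
  have h3 : ∫ τ in (0 : ℝ)..t, (t - τ) ^ (β - 1) * τ ^ p =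
      t ^ (p + 1 + β - 1) * (Real.Gamma (p + 1) * Real.Gamma β / Real.Gamma (p + 1 + β)) := by
    exact_mod_cast h
  rw [h3, show p + 1 + β - 1 = p + β by ring]
  ring

theorem intervalIntegrable_sub_rpow_mul_rpow {β p t : ℝ} (hβ : 0 < β) (hp : -1 < p) (ht : 0 < t) :
    IntervalIntegrable (fun τ => (t - τ) ^ (β - 1) * τ ^ p) MeasureTheory.volume 0 t := by
  by_contra hni
  have h := integral_sub_rpow_mul_rpow hβ hp ht
  rw [intervalIntegral.integral_undef hni] at h
  have h1 := Real.Gamma_pos_of_pos hβ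
  have h2 := Real.Gamma_pos_of_pos (show 0 < p + 1 by linarith)
  have h3 := Real.Gamma_pos_of_pos (show 0 < p + 1 + β by linarith)
  have h4 := Real.rpow_pos_of_pos ht (p + β)
  exact (by positivity : (0 : ℝ) < _).ne h

theorem fracInt_const_add_sum_rpow {β t : ℝ} (hβ : 0 < β) (ht : 0 < t) (s : Finset ℕ) (σ c : ℕ → ℝ)
    (hσ : ∀ r ∈ s, 0 < σ r) (u₀ : ℝ) :
    fracInt β (fun τ => u₀ + ∑ r ∈ s, c r * τ ^ σ r) t =
      u₀ * (t ^ β / Real.Gamma (1 + β)) + ∑ r ∈ s,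
        c r * (Real.Gamma (σ r + 1) / Real.Gamma (σ r + 1 + β) * t ^ (σ r + β)) := by
  have hG := (Real.Gamma_pos_of_pos hβ).ne'
  have e : (fun τ => (t - τ) ^ (β - 1) * (u₀ + ∑ r ∈ s, c r * τ ^ σ r)) =
      fun τ => u₀ * ((t - τ) ^ (β - 1) * τ ^ (0 : ℝ)) +
        ∑ r ∈ s, c r * ((t - τ) ^ (β - 1) * τ ^ σ r) := by
    ext τ
    rw [mul_add, mul_sum, Real.rpow_zero, mul_one, mul_comm]
    congr 1
    exact sum_congr rfl fun r _ => by ring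
  have i0 := (intervalIntegrable_sub_rpow_mul_rpow hβ (show (-1 : ℝ) < 0 by norm_num) ht).const_mul
    u₀
  have ir (r) (hr : r ∈ s) := (intervalIntegrable_sub_rpow_mul_rpow hβ
    (show -1 < σ r by linarith [hσ r hr]) ht).const_mul (c r)
  rw [fracInt, e, intervalIntegral.integral_add i0 (by
      simpa only [Finset.sum_fn] using IntervalIntegrable.sum s ir),
    intervalIntegral.integral_finsetSum ir, intervalIntegral.integral_const_mul,
    integral_sub_rpow_mul_rpow hβ (by norm_num) ht, zero_add, zero_add, Real.Gamma_one, mul_add,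
    mul_sum]
  congr 1
  · field_simp
  · refine sum_congr rfl fun r hr => ?_
    rw [intervalIntegral.integral_const_mul,
      integral_sub_rpow_mul_rpow hβ (by linarith [hσ r hr]) ht]
    field_simp

/-! ### The corrected quadrature -/

theorem fracInt_sub_corrQuad {β h : ℝ} (hβ : 0 < β) (hh : 0 < h) {n : ℕ} (hn : 1 ≤ n) (m : ℕ)
    (s : Finset ℕ) (σ c W : ℕ → ℝ) (hσ : ∀ r ∈ s, 0 < σ r) (u₀ : ℝ) (u : ℝ → ℝ)
    (hu : ∀ t, u t = u₀ + ∑ r ∈ s, c r * t ^ σ r) :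
    fracInt β u (n * h) - corrQuad β h (omegaCoef β) W (Bweight β (omegaCoef β) W m n) m n
        (fun k => u (k * h)) =
      ∑ r ∈ s, c r * h ^ (σ r + β) *
        (Real.Gamma (σ r + 1) / Real.Gamma (σ r + 1 + β) * (n : ℝ) ^ (σ r + β) -
          ∑ k ∈ range (n + 1), omegaCoef β (n - k) * (k : ℝ) ^ σ r -
          ∑ k ∈ Icc 1 m, W k * (k : ℝ) ^ σ r) := by
  have hn' : (0 : ℝ) < n := by exact_mod_cast hn
  have hg (k : ℕ) : u (k * h) = u₀ + ∑ r ∈ s, c r * h ^ σ r * (k : ℝ) ^ σ r := by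
    rw [hu]
    congr 1
    refine sum_congr rfl fun r _ => ?_
    rw [Real.mul_rpow k.cast_nonneg hh.le]
    ring
  have hg0 : u ((0 : ℕ) * h) = u₀ := by
    rw [hg, sum_eq_zero, add_zero]
    intro r hr
    rw [Nat.cast_zero, Real.zero_rpow (hσ r hr).ne', mul_zero]
  have hsum (v : ℕ → ℝ) (S : Finset ℕ) : ∑ k ∈ S, v k * u (k * h) =
      (∑ k ∈ S, v k) * u₀ + ∑ r ∈ s, c r * h ^ σ r * ∑ k ∈ S, v k * (k : ℝ) ^ σ r := by
    simp_rw [hg, mul_add, sum_add_distrib, ← sum_mul, mul_sum]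
    rw [sum_comm]
    congr 1
    exact sum_congr rfl fun r _ => sum_congr rfl fun k _ => by ring
  rw [funext hu, fracInt_const_add_sum_rpow hβ (mul_pos hn' hh) s σ c hσ, ← funext hu, corrQuad,
    hsum (fun k => omegaCoef β (n - k)), hsum W, hg0, Bweight, Real.mul_rpow hn'.le hh.le]
  have hfrac : ∑ r ∈ s, c r * (Real.Gamma (σ r + 1) / Real.Gamma (σ r + 1 + β) *
      ((n : ℝ) * h) ^ (σ r + β)) = h ^ β * ∑ r ∈ s, c r * h ^ σ r *
        (Real.Gamma (σ r + 1) / Real.Gamma (σ r + 1 + β) * (n : ℝ) ^ (σ r + β)) := by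
    rw [mul_sum]
    refine sum_congr rfl fun r _ => ?_
    rw [Real.mul_rpow hn'.le hh.le, Real.rpow_add hh]
    ring
  have hres : ∑ r ∈ s, c r * h ^ (σ r + β) *
        (Real.Gamma (σ r + 1) / Real.Gamma (σ r + 1 + β) * (n : ℝ) ^ (σ r + β) -
          ∑ k ∈ range (n + 1), omegaCoef β (n - k) * (k : ℝ) ^ σ r -
          ∑ k ∈ Icc 1 m, W k * (k : ℝ) ^ σ r) =
      h ^ β * (∑ r ∈ s, c r * h ^ σ r *
        (Real.Gamma (σ r + 1) / Real.Gamma (σ r + 1 + β) * (n : ℝ) ^ (σ r + β)) -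
        ∑ r ∈ s, c r * h ^ σ r * ∑ k ∈ range (n + 1), omegaCoef β (n - k) * (k : ℝ) ^ σ r -
        ∑ r ∈ s, c r * h ^ σ r * ∑ k ∈ Icc 1 m, W k * (k : ℝ) ^ σ r) := by
    rw [← sum_sub_distrib, ← sum_sub_distrib, mul_sum]
    refine sum_congr rfl fun r _ => ?_
    rw [Real.rpow_add hh]
    ring
  rw [hfrac, hres]
  ring

theorem IsStartWeights.sum_mul_eq {β : ℝ} {σ : ℕ → ℝ} {m n : ℕ} {W : ℕ → ℝ}
    (hW : IsStartWeights β σ m n W) {l : ℕ → ℝ} {p : ℝ}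
    (hl : ∀ k ∈ Icc 1 m, (k : ℝ) ^ p = ∑ r ∈ Icc 1 m, l r * (k : ℝ) ^ σ r) :
    ∑ k ∈ Icc 1 m, W k * (k : ℝ) ^ p = ∑ r ∈ Icc 1 m, l r *
      (Real.Gamma (σ r + 1) / Real.Gamma (σ r + 1 + β) * (n : ℝ) ^ (σ r + β) -
        ∑ k ∈ range (n + 1), omegaCoef β (n - k) * (k : ℝ) ^ σ r) := by
  calc ∑ k ∈ Icc 1 m, W k * (k : ℝ) ^ p
      = ∑ k ∈ Icc 1 m, ∑ r ∈ Icc 1 m, l r * (W k * (k : ℝ) ^ σ r) :=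
        sum_congr rfl fun k hk => by
          rw [hl k hk, mul_sum]
          exact sum_congr rfl fun r _ => by ring
    _ = ∑ r ∈ Icc 1 m, l r * ∑ k ∈ Icc 1 m, W k * (k : ℝ) ^ σ r := by
        rw [sum_comm]
        simp_rw [mul_sum]
    _ = _ := sum_congr rfl fun r hr => by rw [hW r hr]

theorem rpow_mul_rpow_max_le {h s b : ℝ} (hh : 0 < h) {n : ℕ} (hn : 1 ≤ n) :
    h ^ (s + b) * (n : ℝ) ^ (max (s - 1) 0 + (b - 1)) ≤
      h ^ 2 * ((n : ℝ) * h) ^ (s + b - 2) + h ^ (1 + s) * ((n : ℝ) * h) ^ (b - 1) := by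
  have hn' : (0 : ℝ) < n := by exact_mod_cast hn
  have h₁ : h ^ (s + b) = h ^ 2 * h ^ (s + b - 2) := by
    rw [← Real.rpow_two, ← Real.rpow_add hh]; congr 1; ring
  have h₂ : h ^ (s + b) = h ^ (1 + s) * h ^ (b - 1) := by
    rw [← Real.rpow_add hh]; congr 1; ring
  rw [Real.mul_rpow hn'.le hh.le, Real.mul_rpow hn'.le hh.le]
  rcases le_total (s - 1) 0 with hs | hs
  · rw [max_eq_right hs, zero_add, h₂]
    have : 0 ≤ h ^ 2 * ((n : ℝ) ^ (s + b - 2) * h ^ (s + b - 2)) := by positivity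
    linarith
  · rw [max_eq_left hs, show s - 1 + (b - 1) = s + b - 2 by ring, h₁]
    have : 0 ≤ h ^ (1 + s) * ((n : ℝ) ^ (b - 1) * h ^ (b - 1)) := by positivity
    linarith

end FracQuad

/-- Equations (2.12)–(2.13): corrected fractional quadrature error for a
finite monomial sum `u(t) = u₀ + Σ_{r=1}^{m+1} c_r t^{σ_r}`. -/
theorem corrected_quadrature_error (β T : ℝ) (hβ0 : 0 < β) (hβ1 : β < 1)
    (hT : 0 < T) (m : ℕ) (hm : 0 < m) (σ : ℕ → ℝ)
    (hmono : StrictMonoOn σ (Set.Icc 1 (m + 1))) (hpos : 0 < σ 1)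
    (u₀ : ℝ) (c : ℕ → ℝ) (u : ℝ → ℝ)
    (hu : ∀ t : ℝ, u t = u₀ + ∑ r ∈ Finset.Icc 1 (m + 1), c r * t ^ (σ r)) :
    ∃ C : ℝ, 0 < C ∧ ∀ h : ℝ, 0 < h → ∀ n : ℕ, 1 ≤ n → (n : ℝ) * h ≤ T →
      ∀ W : ℕ → ℝ, IsStartWeights β σ m n W →
        |fracInt β u ((n : ℝ) * h) -
            corrQuad β h (omegaCoef β) W (Bweight β (omegaCoef β) W m n) m n
              (fun k => u ((k : ℝ) * h))| ≤
          C * (h ^ 2 * ((n : ℝ) * h) ^ (σ (m + 1) + β - 2) +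
            h ^ (1 + σ (m + 1)) * ((n : ℝ) * h) ^ (β - 1)) := by
  have hmem {r : ℕ} (hr : r ∈ Finset.Icc 1 (m + 1)) : r ∈ Set.Icc 1 (m + 1) := Finset.mem_Icc.1 hr
  have htop : m + 1 ∈ Finset.Icc 1 (m + 1) := Finset.mem_Icc.2 ⟨by omega, le_rfl⟩
  have hσ (r : ℕ) (hr : r ∈ Finset.Icc 1 (m + 1)) : 0 < σ r :=
    hpos.trans_le (hmono.monotoneOn ⟨le_rfl, by omega⟩ (hmem hr) (hmem hr).1)
  obtain ⟨l, hl⟩ := FracQuad.exists_rpow_eq_sum_mul_rpow m σ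
    (hmono.injOn.mono (Set.Icc_subset_Icc_right m.le_succ)) (σ (m + 1))
  choose! M hM hR using fun r (hr : r ∈ Finset.Icc 1 (m + 1)) =>
    FracQuad.exists_abs_quadrature_remainder_le hβ0 (hσ r hr)
  have hsub {r : ℕ} (hr : r ∈ Finset.Icc 1 m) : r ∈ Finset.Icc 1 (m + 1) :=
    Finset.Icc_subset_Icc_right m.le_succ hr
  set K := M (m + 1) + ∑ r ∈ Finset.Icc 1 m, |l r| * M r with hK
  have hK0 : 0 < K := add_pos_of_pos_of_nonneg (hM _ htop)
    (Finset.sum_nonneg fun r hr => mul_nonneg (abs_nonneg _) (hM r (hsub hr)).le)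
  refine ⟨|c (m + 1)| * K + 1, by positivity, fun h hh n hn _ W hW => ?_⟩
  have hn' : (1 : ℝ) ≤ n := by exact_mod_cast hn
  set R : ℕ → ℝ := fun r =>
    Real.Gamma (σ r + 1) / Real.Gamma (σ r + 1 + β) * (n : ℝ) ^ (σ r + β) -
      ∑ k ∈ Finset.range (n + 1), omegaCoef β (n - k) * (k : ℝ) ^ σ r with hRdef
  set N : ℝ := (n : ℝ) ^ (max (σ (m + 1) - 1) 0 + (β - 1)) with hN
  have hRN (r : ℕ) (hr : r ∈ Finset.Icc 1 (m + 1)) : |R r| ≤ M r * N := by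
    refine (hR r hr n hn).trans (mul_le_mul_of_nonneg_left ?_ (hM r hr).le)
    have := hmono.monotoneOn (hmem hr) (hmem htop) (hmem hr).2
    exact Real.rpow_le_rpow_of_exponent_le hn' (by gcongr)
  have herr : |R (m + 1) - ∑ r ∈ Finset.Icc 1 m, l r * R r| ≤ K * N := by
    rw [hK, add_mul, Finset.sum_mul]
    refine (abs_sub _ _).trans (add_le_add (hRN _ htop) ?_)
    refine (Finset.abs_sum_le_sum_abs _ _).trans (Finset.sum_le_sum fun r hr => ?_)
    rw [abs_mul, mul_assoc]
    exact mul_le_mul_of_nonneg_left (hRN r (hsub hr)) (abs_nonneg _)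
  rw [FracQuad.fracInt_sub_corrQuad hβ0 hh hn m _ σ c W hσ u₀ u hu,
    Finset.sum_Icc_succ_top (by omega), Finset.sum_eq_zero fun r hr => by rw [hW r hr]; ring,
    zero_add, FracQuad.IsStartWeights.sum_mul_eq hW hl, abs_mul, abs_mul,
    abs_of_pos (Real.rpow_pos_of_pos hh _)]
  calc |c (m + 1)| * h ^ (σ (m + 1) + β) * |R (m + 1) - ∑ r ∈ Finset.Icc 1 m, l r * R r|
      ≤ |c (m + 1)| * h ^ (σ (m + 1) + β) * (K * N) := by gcongr
    _ = |c (m + 1)| * K * (h ^ (σ (m + 1) + β) * N) := by ring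
    _ ≤ (|c (m + 1)| * K + 1) * (h ^ (σ (m + 1) + β) * N) := by gcongr; linarith
    _ ≤ _ := by gcongr; exact FracQuad.rpow_mul_rpow_max_le hh hn
end
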